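/- arXiv:2503.19652 — 11 statements merged into one kernel-verified Lean document; each statement's English description precedes it below -/
import Mathlib

section
/- Let (X,d) be a metric space, (T,d_T) a 0-hyperbolic metric space, and φ : T → X an isometric embedding such that every point of X lies within distance δ of the image φ(T). Then (X,d) is 6δ-hyperbolic. -/
open Set Filter

/-- The Gromov product `(x|y)_p = (d(p,x)+d(p,y)-d(x,y))/2`. -/
noncomputable def gromovProduct {X : Type*} [MetricSpace X] (p x y : X) : ℝ :=
  (dist p x + dist p y - dist x y) / 2

/-- Moving two points by at most `δ` each changes their distance by at most `2δ`. -/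
theorem abs_dist_sub_dist_le_two_mul {X : Type*} [MetricSpace X] {δ : ℝ} {a b a' b' : X}
    (ha : dist a a' ≤ δ) (hb : dist b b' ≤ δ) : |dist a b - dist a' b'| ≤ 2 * δ := by
  have h := dist_dist_dist_le a b a' b'
  rw [Real.dist_eq] at h
  linarith

/-- Moving three points by at most `δ` each changes their Gromov product by at most `3δ`. -/
theorem abs_gromovProduct_sub_le_three_mul {X : Type*} [MetricSpace X] {δ : ℝ}
    {p x y p' x' y' : X} (hp : dist p p' ≤ δ) (hx : dist x x' ≤ δ) (hy : dist y y' ≤ δ) :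
    |gromovProduct p x y - gromovProduct p' x' y'| ≤ 3 * δ := by
  have hpx := abs_le.1 (abs_dist_sub_dist_le_two_mul hp hx)
  have hpy := abs_le.1 (abs_dist_sub_dist_le_two_mul hp hy)
  have hxy := abs_le.1 (abs_dist_sub_dist_le_two_mul hx hy)
  unfold gromovProduct
  rw [abs_le]
  constructor <;> linarith [hpx.1, hpx.2, hpy.1, hpy.2, hxy.1, hxy.2]

/-- If `X` admits an isometric embedding `φ` of a `0`-hyperbolic space `T` whose image is
`δ`-dense in `X`, then `X` is `6δ`-hyperbolic. -/
theorem hyperbolic_of_dense_tree {X T : Type*} [MetricSpace X] [MetricSpace T]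
    (δ : ℝ) (hδ : 0 ≤ δ)
    (hT : ∀ p x y z : T,
      gromovProduct p x z ≥ min (gromovProduct p x y) (gromovProduct p y z) - 0)
    (φ : T → X) (hφ : ∀ a b : T, dist (φ a) (φ b) = dist a b)
    (hcover : ∀ x : X, ∃ t : T, dist x (φ t) ≤ δ) :
    ∀ p x y z : X,
      gromovProduct p x z ≥ min (gromovProduct p x y) (gromovProduct p y z) - 6 * δ := by
  intro p x y z
  choose f hf using hcover
  have approx (a b c : X) :
      |gromovProduct a b c - gromovProduct (f a) (f b) (f c)| ≤ 3 * δ := by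
    have h := abs_gromovProduct_sub_le_three_mul (hf a) (hf b) (hf c)
    simpa only [gromovProduct, hφ] using h
  have hxz := abs_le.1 (approx p x z)
  have hxy := abs_le.1 (approx p x y)
  have hyz := abs_le.1 (approx p y z)
  have h := hT (f p) (f x) (f y) (f z)
  rw [ge_iff_le, sub_le_iff_le_add, min_le_iff] at h ⊢
  rcases h with h | h
  · left
    linarith [hxz.1, hxy.2]
  · right
    linarith [hxz.1, hyz.2]
end

section
/- Let (X,d) be a proper, geodesic δ-hyperbolic metric space and f : X → ℝ an L-Lipschitz convex function. Then for every ray ξ : [0,∞) → X there exists a ray ζ : [0,∞) → X with ζ(0) = ξ(0), ζ asymptotic to ξ, and f∘ζ convex on [0,∞). -/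
open Set Filter

/-- A sequence with nonnegative second differences up to `N` has increasing slopes. -/
theorem mul_sub_le_mul_sub_of_second_difference_nonneg {a : ℕ → ℝ} {N : ℕ}
    (ha : ∀ i, i + 2 ≤ N → 2 * a (i + 1) ≤ a i + a (i + 2))
    {i j k : ℕ} (hij : i ≤ j) (hjk : j ≤ k) (hk : k ≤ N) :
    ((k : ℝ) - j) * (a j - a i) ≤ ((j : ℝ) - i) * (a k - a j) := by
  rcases hjk.eq_or_lt with rfl | hlt
  · simp
  have slope_mono : ∀ m n, m ≤ n → n + 1 ≤ N → a (m + 1) - a m ≤ a (n + 1) - a n := by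
    intro m n hmn
    induction n, hmn using Nat.le_induction with
    | base => intro _; exact le_rfl
    | succ n _ ih =>
      intro hn
      have h1 := ih (by omega)
      have h2 := ha n hn
      rw [show n + 1 + 1 = n + 2 from rfl]
      linarith
  have right : ∀ r : ℕ, j + r ≤ N → a j + r * (a (j + 1) - a j) ≤ a (j + r) := by
    intro r
    induction r with
    | zero => intro _; simp
    | succ r ih =>
      intro hr
      have h1 := ih (by omega)
      have h2 := slope_mono j (j + r) (by omega) (by omega)
      rw [show j + (r + 1) = j + r + 1 from rfl]
      push_cast
      linarith
  have left : ∀ r m : ℕ, m + r = j → a j - r * (a (j + 1) - a j) ≤ a m := by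
    intro r
    induction r with
    | zero => intro m hm; simp at hm; simp [hm]
    | succ r ih =>
      intro m hm
      have h1 := ih (m + 1) (by omega)
      have h2 := slope_mono m j (by omega) (by omega)
      push_cast
      linarith
  have hr := right (k - j) (by omega)
  have hl := left (j - i) i (by omega)
  rw [Nat.add_sub_cancel' hjk, Nat.cast_sub hjk] at hr
  rw [Nat.cast_sub hij] at hl
  have hkj : (0 : ℝ) ≤ (k : ℝ) - j := sub_nonneg.2 (by exact_mod_cast hjk)
  have hji : (0 : ℝ) ≤ (j : ℝ) - i := sub_nonneg.2 (by exact_mod_cast hij)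
  calc ((k : ℝ) - j) * (a j - a i) ≤ (k - j) * ((j - i) * (a (j + 1) - a j)) :=
        mul_le_mul_of_nonneg_left (by linarith) hkj
    _ = (j - i) * ((k - j) * (a (j + 1) - a j)) := by ring
    _ ≤ (j - i) * (a k - a j) := mul_le_mul_of_nonneg_left (by linarith) hji

/-- A chain whose steps have length at most `l` and whose endpoints are at distance `N * l` is a
discrete geodesic. -/
theorem dist_eq_of_dist_succ_le {X : Type*} [PseudoMetricSpace X] {x : ℕ → X} {N : ℕ} {l : ℝ}
    (hstep : ∀ i < N, dist (x i) (x (i + 1)) ≤ l) (hN : dist (x 0) (x N) = N * l)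
    {i j : ℕ} (hij : i ≤ j) (hj : j ≤ N) : dist (x i) (x j) = ((j : ℝ) - i) * l := by
  have upper : ∀ m n : ℕ, m ≤ n → n ≤ N → dist (x m) (x n) ≤ ((n : ℝ) - m) * l := by
    intro m n hmn hn
    have := dist_le_Ico_sum_of_dist_le (f := x) (d := fun _ => l) hmn
      (fun {k} _ hk => hstep k (by omega))
    simpa [Nat.cast_sub hmn] using this
  have h1 := upper 0 i (by omega) (by omega)
  have h2 := upper i j hij hj
  have h3 := upper j N hj le_rfl
  have h4 := dist_triangle4 (x 0) (x i) (x j) (x N)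
  push_cast at h1
  linarith

/-- If `f` is continuous and every pair of points has a midpoint at which `f` is at most the
average of its endpoint values, then equally spaced points on a geodesic can be chosen so that the
values of `f` along them have nonnegative second differences. -/
theorem exists_discrete_geodesic_second_difference_nonneg
    {X : Type*} [MetricSpace X] [ProperSpace X] {f : X → ℝ} (hf : Continuous f)
    (hmid : ∀ x y : X, ∃ z, dist x z = dist x y / 2 ∧ dist z y = dist x y / 2 ∧
      2 * f z ≤ f x + f y)
    {p y : X} {N : ℕ} {l : ℝ} (hpy : dist p y = N * l) {c : ℕ → X}
    (hc0 : c 0 = p) (hcN : c N = y) (hc : ∀ i < N, dist (c i) (c (i + 1)) ≤ l) :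
    ∃ x : ℕ → X, x 0 = p ∧ x N = y ∧
      (∀ i j, i ≤ j → j ≤ N → dist (x i) (x j) = ((j : ℝ) - i) * l) ∧
      ∀ i, i + 2 ≤ N → 2 * f (x (i + 1)) ≤ f (x i) + f (x (i + 2)) := by
  set K : Set (ℕ → X) := (univ.pi fun i => Metric.closedBall p (dist p (c i) + i * |l|)) ∩
    {x | x 0 = p ∧ x N = y ∧ ∀ i < N, dist (x i) (x (i + 1)) ≤ l}
  have hKc : IsCompact K := by
    refine (isCompact_univ_pi fun i => isCompact_closedBall _ _).inter_right ?_
    have h0 : IsClosed {x : ℕ → X | x 0 = p} :=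
      isClosed_eq (continuous_apply 0) continuous_const
    have hN : IsClosed {x : ℕ → X | x N = y} :=
      isClosed_eq (continuous_apply N) continuous_const
    have hstep : IsClosed {x : ℕ → X | ∀ i < N, dist (x i) (x (i + 1)) ≤ l} := by
      simp only [ofPred_forall]
      exact isClosed_iInter fun i => isClosed_iInter fun _ =>
        isClosed_le ((continuous_apply i).dist (continuous_apply (i + 1))) continuous_const
    exact h0.inter (hN.inter hstep)
  have hcK : c ∈ K := by
    refine ⟨fun i _ => ?_, hc0, hcN, hc⟩
    rw [Metric.mem_closedBall, dist_comm]
    exact le_add_of_nonneg_right (by positivity)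
  obtain ⟨x, ⟨hxball, hx0, hxN, hx⟩, hmin⟩ := hKc.exists_isMinOn ⟨c, hcK⟩
    (f := fun x => ∑ i ∈ Finset.range (N + 1), f (x i))
    (continuous_finsetSum _ fun i _ => hf.comp (continuous_apply i)).continuousOn
  have hdist : ∀ i j, i ≤ j → j ≤ N → dist (x i) (x j) = ((j : ℝ) - i) * l :=
    fun i j hij hj => dist_eq_of_dist_succ_le hx (by rw [hx0, hxN, hpy]) hij hj
  have hcdist : ∀ i j, i ≤ j → j ≤ N → dist (c i) (c j) = ((j : ℝ) - i) * l :=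
    fun i j hij hj => dist_eq_of_dist_succ_le hc (by rw [hc0, hcN, hpy]) hij hj
  refine ⟨x, hx0, hxN, hdist, fun i hi => ?_⟩
  obtain ⟨z, hz1, hz2, hz⟩ := hmid (x i) (x (i + 2))
  have hii : dist (x i) (x (i + 2)) = 2 * l := by
    rw [hdist i (i + 2) (by omega) hi]; push_cast; ring
  have hl1 : dist (x i) z = l := by rw [hz1, hii]; ring
  have hl2 : dist z (x (i + 2)) = l := by rw [hz2, hii]; ring
  have hz_mem : Function.update x (i + 1) z ∈ K := by
    refine ⟨fun m _ => ?_, ?_, ?_, fun m hm => ?_⟩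
    · rcases eq_or_ne m (i + 1) with rfl | hne
      · rw [Function.update_self, Metric.mem_closedBall, dist_comm]
        have h1 := hdist 0 i (by omega) (by omega)
        have h2 := hcdist 0 (i + 1) (by omega) (by omega)
        rw [hx0] at h1
        rw [hc0] at h2
        have h3 := dist_triangle p (x i) z
        have h4 : 0 ≤ ((i + 1 : ℕ) : ℝ) * |l| := by positivity
        rw [h2]
        push_cast at *
        linarith
      · rw [Function.update_of_ne hne]
        exact hxball m (mem_univ m)
    · rw [Function.update_of_ne (by omega), hx0]
    · rw [Function.update_of_ne (by omega), hxN]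
    · rcases eq_or_ne m (i + 1) with rfl | hne
      · rw [Function.update_self, Function.update_of_ne (by omega)]
        exact hl2.le
      · rcases eq_or_ne m i with rfl | hne'
        · rw [Function.update_self, Function.update_of_ne hne]
          exact hl1.le
        · rw [Function.update_of_ne hne, Function.update_of_ne (by omega)]
          exact hx m hm
  have hle := isMinOn_iff.1 hmin _ hz_mem
  have hmem : i + 1 ∈ Finset.range (N + 1) := Finset.mem_range.2 (by omega)
  beta_reduce at hle
  have hsum : ∑ m ∈ (Finset.range (N + 1)).erase (i + 1), f (Function.update x (i + 1) z m) =
      ∑ m ∈ (Finset.range (N + 1)).erase (i + 1), f (x m) :=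
    Finset.sum_congr rfl fun m hm => by rw [Function.update_of_ne (Finset.ne_of_mem_erase hm)]
  rw [← Finset.add_sum_erase _ _ hmem, ← Finset.add_sum_erase _ _ hmem, Function.update_self,
    hsum] at hle
  linarith

/-- In a Gromov hyperbolic space, a point on a geodesic from `p` to `y` is close to the point of
another such geodesic at a comparable distance from `p`. -/
theorem dist_le_of_gromovProduct {X : Type*} [MetricSpace X] {δ : ℝ}
    (hhyp : ∀ p x y z : X,
      gromovProduct p x z ≥ min (gromovProduct p x y) (gromovProduct p y z) - δ)
    {p y u v : X} (hu : dist p u + dist u y = dist p y) (hv : dist p v + dist v y = dist p y) :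
    dist u v ≤ |dist p u - dist p v| + 2 * δ := by
  have h := hhyp p u y v
  have e1 : gromovProduct p u y = dist p u := by unfold gromovProduct; linarith
  have e2 : gromovProduct p y v = dist p v := by
    unfold gromovProduct; rw [dist_comm y v]; linarith
  rw [e1, e2] at h
  unfold gromovProduct at h
  rcases le_total (dist p u) (dist p v) with hle | hle
  · rw [min_eq_left hle] at h
    rw [abs_of_nonpos (by linarith)]
    linarith
  · rw [min_eq_right hle] at h
    rw [abs_of_nonneg (by linarith)]
    linarith

/-- In a proper, geodesic `δ`-hyperbolic space, for an `L`-Lipschitz convex function `f` and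
any ray `ξ`, there is a ray `ζ` starting at `ξ(0)`, asymptotic to `ξ`, along which `f` is
convex. -/
theorem exists_asymptotic_ray_with_convex_composition
    {X : Type*} [MetricSpace X] [ProperSpace X] (δ : ℝ) (hδ : 0 ≤ δ)
    (hgeo : ∀ x y : X, ∃ γ : ℝ → X, γ 0 = x ∧ γ 1 = y ∧
      ∀ s ∈ Icc (0:ℝ) 1, ∀ t ∈ Icc (0:ℝ) 1, dist (γ s) (γ t) = |s - t| * dist x y)
    (hhyp : ∀ p x y z : X,
      gromovProduct p x z ≥ min (gromovProduct p x y) (gromovProduct p y z) - δ)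
    (L : ℝ) (hL : 0 < L) (f : X → ℝ)
    (hf : ∀ x y : X, |f x - f y| ≤ L * dist x y)
    (hconv : ∀ x y : X, ∃ γ : ℝ → X, γ 0 = x ∧ γ 1 = y ∧
      (∀ s ∈ Icc (0:ℝ) 1, ∀ t ∈ Icc (0:ℝ) 1, dist (γ s) (γ t) = |s - t| * dist x y) ∧
      ∀ s ∈ Icc (0:ℝ) 1, f (γ s) ≤ (1 - s) * f x + s * f y)
    (ξ : ℝ → X)
    (hξ : ∀ s ∈ Ici (0:ℝ), ∀ t ∈ Ici (0:ℝ), dist (ξ s) (ξ t) = |s - t|) :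
    ∃ ζ : ℝ → X,
      (∀ s ∈ Ici (0:ℝ), ∀ t ∈ Ici (0:ℝ), dist (ζ s) (ζ t) = |s - t|) ∧
      ζ 0 = ξ 0 ∧
      (∃ C : ℝ, ∀ t ≥ (0:ℝ), dist (ξ t) (ζ t) ≤ C) ∧
      ConvexOn ℝ (Ici (0:ℝ)) (fun t => f (ζ t)) := by
  have hfc : Continuous f :=
    (LipschitzWith.of_dist_le' fun x y => by
      rw [Real.dist_eq]; exact hf x y).continuous
  have hmid : ∀ x y : X, ∃ z, dist x z = dist x y / 2 ∧ dist z y = dist x y / 2 ∧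
      2 * f z ≤ f x + f y := by
    intro x y
    obtain ⟨γ, h0, h1, hd, hc⟩ := hconv x y
    have a := hd 0 (by norm_num) (1 / 2) (by norm_num)
    have b := hd (1 / 2) (by norm_num) 1 (by norm_num)
    have c := hc (1 / 2) (by norm_num)
    rw [h0] at a
    rw [h1] at b
    norm_num [abs_of_pos] at a b
    exact ⟨γ (1 / 2), by norm_num; linarith, by norm_num; linarith, by linarith⟩
  have hchain : ∀ n : ℕ, ∃ x : ℕ → X, x 0 = ξ 0 ∧ x (n * (n + 1)) = ξ n ∧
      (∀ i j, i ≤ j → j ≤ n * (n + 1) →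
        dist (x i) (x j) = ((j : ℝ) - i) * ((n : ℝ) + 1)⁻¹) ∧
      ∀ i, i + 2 ≤ n * (n + 1) → 2 * f (x (i + 1)) ≤ f (x i) + f (x (i + 2)) := by
    intro n
    have hn : (0 : ℝ) < (n : ℝ) + 1 := by positivity
    refine exists_discrete_geodesic_second_difference_nonneg hfc hmid
      (c := fun i => ξ (i * ((n : ℝ) + 1)⁻¹)) ?_ (by simp) ?_ ?_
    · rw [hξ 0 self_mem_Ici n (mem_Ici.2 n.cast_nonneg), zero_sub, abs_neg, Nat.abs_cast]
      push_cast
      field_simp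
    · congr 1
      push_cast
      field_simp
    · intro i _
      rw [hξ _ (mem_Ici.2 (by positivity)) _ (mem_Ici.2 (by positivity))]
      push_cast
      rw [← sub_mul, sub_add_cancel_left, neg_one_mul, abs_neg, abs_of_pos (by positivity)]
  choose x hx0 hxN hxd hxc using hchain
  set U : Ultrafilter ℕ := hyperfilter ℕ
  have hU : (U : Filter ℕ) ≤ atTop := Nat.hyperfilter_le_atTop
  set ι : ℝ → ℕ → ℕ := fun t n => ⌊t * ((n : ℝ) + 1)⌋₊ with hι
  have hιle : ∀ t : ℝ, ∀ᶠ n in (U : Filter ℕ), ι t n ≤ n * (n + 1) := by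
    intro t
    filter_upwards [hU (eventually_ge_atTop ⌈t⌉₊)] with n hn
    refine Nat.floor_le_of_le ?_
    push_cast
    exact mul_le_mul_of_nonneg_right (Nat.ceil_le.1 hn) (by positivity)
  have hιmono : ∀ s t : ℝ, s ≤ t → ∀ n, ι s n ≤ ι t n := fun s t hst n =>
    Nat.floor_le_floor (mul_le_mul_of_nonneg_right hst (by positivity))
  have hιlim : ∀ t : ℝ, 0 ≤ t →
      Tendsto (fun n => (ι t n : ℝ) * ((n : ℝ) + 1)⁻¹) U (nhds t) := by
    intro t ht
    have h := (tendsto_nat_floor_mul_div_atTop ht).comp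
      (tendsto_atTop_add_const_right atTop (1 : ℝ) tendsto_natCast_atTop_atTop)
    exact (h.mono_left hU)
  have hlim : ∀ t : ℝ, ∃ z, Tendsto (fun n => x n (ι t n)) U (nhds z) := by
    intro t
    have hball : ∀ᶠ n in (U : Filter ℕ), x n (ι t n) ∈ Metric.closedBall (ξ 0) |t| := by
      filter_upwards [hιle t] with n hn
      have h := hxd n 0 (ι t n) (Nat.zero_le _) hn
      rw [Metric.mem_closedBall, dist_comm, ← hx0 n, h]
      have h1 : (ι t n : ℝ) ≤ |t| * ((n : ℝ) + 1) :=
        (Nat.cast_le.2 (hιmono t |t| (le_abs_self t) n)).trans (Nat.floor_le (by positivity))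
      rw [Nat.cast_zero, sub_zero, ← div_eq_mul_inv, div_le_iff₀ (by positivity)]
      exact h1
    obtain ⟨z, _, hz⟩ := (isCompact_closedBall (ξ 0) |t|).ultrafilter_le_nhds'
      (U.map fun n => x n (ι t n)) hball
    exact ⟨z, hz⟩
  choose ζ hζ using hlim
  have hdist : ∀ s t : ℝ, 0 ≤ s → s ≤ t → dist (ζ s) (ζ t) = t - s := by
    intro s t hs hst
    refine tendsto_nhds_unique ((hζ s).dist (hζ t)) ?_
    refine ((hιlim t (hs.trans hst)).sub (hιlim s hs)).congr' ?_
    filter_upwards [hιle t] with n hn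
    rw [hxd n _ _ (hιmono s t hst n) hn, sub_mul]
  refine ⟨ζ, ?_, ?_, ⟨2 * δ, ?_⟩, ?_⟩
  · intro s hs t ht
    rcases le_total s t with h | h
    · rw [hdist s t hs h, abs_sub_comm, abs_of_nonneg (sub_nonneg.2 h)]
    · rw [dist_comm, hdist t s ht h, abs_of_nonneg (sub_nonneg.2 h)]
  · refine tendsto_nhds_unique (hζ 0) ?_
    simp [hι, hx0]
  · intro t ht
    have hbound : Tendsto (fun n => |t - (ι t n : ℝ) * ((n : ℝ) + 1)⁻¹| + 2 * δ) U
        (nhds (|t - t| + 2 * δ)) := ((hιlim t ht).const_sub t).abs.add_const _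
    rw [sub_self, abs_zero, zero_add] at hbound
    refine le_of_tendsto_of_tendsto (tendsto_const_nhds.dist (hζ t)) hbound ?_
    filter_upwards [hιle t, hU (eventually_ge_atTop ⌈t⌉₊)] with n hn hnt
    have hpv : dist (ξ 0) (x n (ι t n)) = (ι t n : ℝ) * ((n : ℝ) + 1)⁻¹ := by
      rw [← hx0 n, hxd n 0 _ (Nat.zero_le _) hn, Nat.cast_zero, sub_zero]
    have hvy : dist (x n (ι t n)) (ξ n) = n - (ι t n : ℝ) * ((n : ℝ) + 1)⁻¹ := by
      rw [← hxN n, hxd n _ _ hn le_rfl]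
      push_cast
      field_simp
    have hpy : dist (ξ 0) (ξ n) = n := by
      rw [hξ 0 self_mem_Ici n (mem_Ici.2 n.cast_nonneg), zero_sub, abs_neg, Nat.abs_cast]
    have hpu : dist (ξ 0) (ξ t) = t := by
      rw [hξ 0 self_mem_Ici t ht, zero_sub, abs_neg, abs_of_nonneg ht]
    have huy : dist (ξ t) (ξ n) = n - t := by
      rw [hξ t ht n (mem_Ici.2 n.cast_nonneg), abs_sub_comm,
        abs_of_nonneg (sub_nonneg.2 (Nat.ceil_le.1 hnt))]
    have h := dist_le_of_gromovProduct hhyp (p := ξ 0) (y := ξ n) (u := ξ t) (v := x n (ι t n))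
      (by linarith) (by linarith)
    rwa [hpu, hpv] at h
  · refine convexOn_of_slope_mono_adjacent (convex_Ici 0) ?_
    intro r s t hr ht hrs hst
    have hr0 : (0 : ℝ) ≤ r := hr
    have hs0 : 0 ≤ s := hr0.trans hrs.le
    have ht0 : 0 ≤ t := ht
    have hfl : ∀ u, Tendsto (fun n => f (x n (ι u n))) U (nhds (f (ζ u))) := fun u =>
      (hfc.tendsto _).comp (hζ u)
    rw [div_le_div_iff₀ (sub_pos.2 hrs) (sub_pos.2 hst), mul_comm, mul_comm (f (ζ t) - f (ζ s))]
    refine le_of_tendsto_of_tendsto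
      (((hιlim t ht0).sub (hιlim s hs0)).mul ((hfl s).sub (hfl r)))
      (((hιlim s hs0).sub (hιlim r hr0)).mul ((hfl t).sub (hfl s))) ?_
    filter_upwards [hιle t] with n hn
    have h := mul_sub_le_mul_sub_of_second_difference_nonneg (a := fun i => f (x n i)) (hxc n)
      (hιmono r s hrs.le n) (hιmono s t hst.le n) hn
    have h' := mul_le_mul_of_nonneg_left h (show (0 : ℝ) ≤ ((n : ℝ) + 1)⁻¹ by positivity)
    linarith
end

section
/- Let (X,d) be a proper, geodesic δ-hyperbolic metric space, f : X → ℝ an L-Lipschitz convex function, p ∈ X, and ζ₁, ζ₂ : [0,∞) → X two rays with ζ₁(0) = ζ₂(0) = p which are not asymptotic and such that sup_{t>0} (ζ₁(t)|ζ₂(t))_p < ∞ (i.e., they represent distinct boundary points). Then there exists a unit-speed geodesic line ξ : ℝ → X (d(ξ(s),ξ(t)) = |s−t| for all s,t ∈ ℝ) such that f∘ξ is convex on ℝ, the ray t ↦ ξ(−t) is asymptotic to ζ₁, and the ray t ↦ ξ(t) is asymptotic to ζ₂. -/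
open Set Filter

/-- A sequence with nonnegative second differences on `[0, N]` has nondecreasing slopes. -/
lemma slope_mono_of_second_difference_nonneg {a : ℕ → ℝ} {N : ℕ}
    (h : ∀ i, i + 2 ≤ N → 2 * a (i + 1) ≤ a i + a (i + 2)) {i j k : ℕ}
    (hij : i ≤ j) (hjk : j ≤ k) (hk : k ≤ N) :
    (a j - a i) * (k - j) ≤ (a k - a j) * (j - i) := by
  have left : ∀ j, i ≤ j → j + 1 ≤ N → a j - a i ≤ (j - i) * (a (j + 1) - a j) := by
    intro j hj
    induction j, hj using Nat.le_induction with
    | base => intro _; simp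
    | succ j hj ih =>
      intro hN
      have hc : (i : ℝ) ≤ j := by exact_mod_cast hj
      have h1 := ih (by omega)
      have h2 := h j (by omega)
      push_cast
      nlinarith
  have right : ∀ k, j ≤ k → k + 1 ≤ N → a j - a i ≤ (j - i) * (a (k + 1) - a k) := by
    intro k hk
    induction k, hk using Nat.le_induction with
    | base => exact left j hij
    | succ k hk ih =>
      intro hN
      have hc : (i : ℝ) ≤ j := by exact_mod_cast hij
      have h1 := ih (by omega)
      have h2 := h k (by omega)
      nlinarith
  induction k, hjk using Nat.le_induction with
  | base => simp
  | succ k hjk ih =>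
    have h1 := ih (by omega)
    have h2 := right k hjk hk
    push_cast
    linarith

/-- A chain of `N` steps of length at most `h` joining two points at distance `N * h` is an
isometric embedding of `{0, …, N}`, up to scaling by `h`. -/
lemma dist_eq_of_chain {X : Type*} [MetricSpace X] {c : ℕ → X} {N : ℕ} {h : ℝ}
    (hc : ∀ i < N, dist (c i) (c (i + 1)) ≤ h) (hN : dist (c 0) (c N) = N * h) {i j : ℕ}
    (hi : i ≤ N) (hj : j ≤ N) : dist (c i) (c j) = |(i : ℝ) - j| * h := by
  have upper : ∀ i j, i ≤ j → j ≤ N → dist (c i) (c j) ≤ ((j : ℝ) - i) * h := by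
    intro i j hij
    induction j, hij using Nat.le_induction with
    | base => intro _; simp
    | succ j hj ih =>
      intro hN
      have h1 := ih (by omega)
      have h2 := hc j (by omega)
      have h3 := dist_triangle (c i) (c j) (c (j + 1))
      push_cast
      linarith
  wlog hij : i ≤ j generalizing i j
  · rw [dist_comm, abs_sub_comm]
    exact this hj hi (by omega)
  have hij' : (i : ℝ) - j ≤ 0 := sub_nonpos.2 (by exact_mod_cast hij)
  rw [abs_of_nonpos hij']
  have h1 := upper 0 i (by omega) hi
  have h2 := upper i j hij hj
  have h3 := upper j N hj le_rfl
  have h4 := dist_triangle4 (c 0) (c i) (c j) (c N)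
  push_cast at h1
  linarith

/-- If `f` satisfies the midpoint inequality at some midpoint of any two points, then any two
points are joined by a subdivided geodesic along which `f` has nonnegative second differences. -/
lemma exists_convex_chain {X : Type*} [MetricSpace X] [ProperSpace X] {f : X → ℝ}
    (hf : Continuous f)
    (hgeo : ∀ x y : X, ∃ γ : ℝ → X, γ 0 = x ∧ γ 1 = y ∧
      ∀ s ∈ Icc (0:ℝ) 1, ∀ t ∈ Icc (0:ℝ) 1, dist (γ s) (γ t) = |s - t| * dist x y)
    (hmid : ∀ x y : X, ∃ m, dist x m = dist x y / 2 ∧ dist m y = dist x y / 2 ∧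
      2 * f m ≤ f x + f y)
    (x y : X) {N : ℕ} (hN : 0 < N) :
    ∃ c : ℕ → X, c 0 = x ∧ c N = y ∧
      (∀ i ≤ N, ∀ j ≤ N, dist (c i) (c j) = |(i : ℝ) - j| * (dist x y / N)) ∧
      ∀ i, i + 2 ≤ N → 2 * f (c (i + 1)) ≤ f (c i) + f (c (i + 2)) := by
  have hN' : (0 : ℝ) < N := by exact_mod_cast hN
  set h := dist x y / N with hh
  have hNh : dist x y = N * h := by rw [hh]; field_simp
  have h0 : 0 ≤ h := by positivity
  let K : Set (ℕ → X) := Set.pi univ (fun _ => Metric.closedBall x (dist x y)) ∩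
    {c | c 0 = x ∧ c N = y ∧ ∀ i < N, dist (c i) (c (i + 1)) ≤ h}
  have hKc : IsCompact K := by
    refine (isCompact_univ_pi fun _ => isCompact_closedBall _ _).inter_right ?_
    refine (isClosed_eq (by fun_prop) (by fun_prop)).and
      ((isClosed_eq (by fun_prop) (by fun_prop)).and ?_)
    simp only [ofPred_forall]
    exact isClosed_iInter fun i => isClosed_iInter fun _ =>
      isClosed_le (by fun_prop) (by fun_prop)
  have hKne : K.Nonempty := by
    obtain ⟨γ, hγ0, hγ1, hγ⟩ := hgeo x y
    have mem : ∀ i : ℕ, i ≤ N → (i : ℝ) / N ∈ Icc (0 : ℝ) 1 := fun i hi =>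
      ⟨by positivity, (div_le_one hN').2 (by exact_mod_cast hi)⟩
    refine ⟨fun i => γ ((min i N : ℕ) / N), fun i _ => ?_, ?_, ?_, fun i hi => ?_⟩
    · have hi := mem (min i N) (min_le_right _ _)
      have h1 := hγ _ hi 0 (by simp)
      rw [hγ0, sub_zero, abs_of_nonneg hi.1] at h1
      rw [Metric.mem_closedBall, h1]
      exact mul_le_of_le_one_left dist_nonneg hi.2
    · simpa using hγ0
    · simpa [hN'.ne'] using hγ1
    · beta_reduce
      rw [min_eq_left hi.le, min_eq_left (Nat.succ_le_of_lt hi), hγ _ (mem i hi.le) _ (mem _ hi),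
        ← sub_div, abs_div, abs_of_pos hN', hNh]
      push_cast
      rw [sub_add_cancel_left, abs_neg, abs_one]
      exact le_of_eq (by field_simp)
  obtain ⟨c, hcK, hmin⟩ := hKc.exists_isMinOn hKne
    (f := fun c => ∑ i ∈ Finset.range (N + 1), f (c i)) (by fun_prop)
  obtain ⟨hball, hc0, hcN, hstep⟩ := hcK
  have hdist : ∀ i ≤ N, ∀ j ≤ N, dist (c i) (c j) = |(i : ℝ) - j| * h := fun i hi j hj =>
    dist_eq_of_chain hstep (by rw [hc0, hcN, hNh]) hi hj
  refine ⟨c, hc0, hcN, hdist, fun i hi => ?_⟩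
  obtain ⟨m, hm1, hm2, hfm⟩ := hmid (c i) (c (i + 2))
  have hd : dist (c i) (c (i + 2)) = 2 * h := by
    rw [hdist i (by omega) (i + 2) hi]
    push_cast
    rw [sub_add_cancel_left, abs_neg, abs_two]
  rw [hd, mul_div_cancel_left₀ _ (two_ne_zero)] at hm1 hm2
  have hmK : Function.update c (i + 1) m ∈ K := by
    refine ⟨fun j _ => ?_, ?_, ?_, fun j hj => ?_⟩
    · rcases eq_or_ne j (i + 1) with rfl | hne
      · rw [Function.update_self, Metric.mem_closedBall]
        have h1 := hdist i (by omega) 0 (by omega)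
        rw [hc0, Nat.cast_zero, sub_zero, Nat.abs_cast] at h1
        have h2 := dist_triangle m (c i) x
        rw [dist_comm m (c i), hm1, h1] at h2
        have h3 : ((i : ℝ) + 2) ≤ N := by exact_mod_cast hi
        rw [hNh]
        nlinarith
      · rw [Function.update_of_ne hne]
        exact hball j (mem_univ _)
    · rw [Function.update_of_ne (by omega), hc0]
    · rw [Function.update_of_ne (by omega), hcN]
    · rcases eq_or_ne j (i + 1) with rfl | hne
      · rw [Function.update_self, Function.update_of_ne (by omega)]
        exact hm2.le
      · rw [Function.update_of_ne hne]
        rcases eq_or_ne j i with rfl | hne'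
        · rw [Function.update_self]
          exact hm1.le
        · rw [Function.update_of_ne (by omega)]
          exact hstep j hj
  have hle := hmin hmK
  have hi' : i + 1 ∈ Finset.range (N + 1) := Finset.mem_range.2 (by omega)
  simp only [mem_ofPred_eq] at hle
  have hsum : ∑ j ∈ (Finset.range (N + 1)).erase (i + 1), f (Function.update c (i + 1) m j)
      = ∑ j ∈ (Finset.range (N + 1)).erase (i + 1), f (c j) :=
    Finset.sum_congr rfl fun j hj => by
      rw [Function.update_of_ne (Finset.ne_of_mem_erase hj)]
  rw [← Finset.add_sum_erase _ _ hi', ← Finset.add_sum_erase _ _ hi', Function.update_self,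
    hsum] at hle
  linarith

/-- Pointwise bounded families of maps into a proper space converge pointwise along an
ultrafilter. -/
lemma exists_pointwise_limit {ι T X : Type*} [MetricSpace X] [ProperSpace X]
    (U : Ultrafilter ι) (g : ι → T → X) {S : Set T} (x : X)
    (hg : ∀ t ∈ S, ∃ R, ∀ᶠ n in U, dist (g n t) x ≤ R) :
    ∃ γ : T → X, ∀ t ∈ S, Tendsto (fun n => g n t) U (nhds (γ t)) := by
  have key : ∀ t, ∃ y, t ∈ S → Tendsto (fun n => g n t) U (nhds y) := by
    intro t
    by_cases ht : t ∈ S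
    · obtain ⟨R, hR⟩ := hg t ht
      obtain ⟨y, -, hy⟩ := (isCompact_closedBall x R).ultrafilter_le_nhds
        (U.map fun n => g n t) (le_principal_iff.2 hR)
      exact ⟨y, fun _ => hy⟩
    · exact ⟨x, fun h => absurd h ht⟩
  choose γ hγ using key
  exact ⟨γ, hγ⟩

/-- In a proper geodesic space, if `f` satisfies the midpoint inequality at some midpoint of any
two points, then any two points are joined by a geodesic along which `f` is convex. -/
lemma exists_convexOn_geodesic {X : Type*} [MetricSpace X] [ProperSpace X] {f : X → ℝ}
    (hf : Continuous f)
    (hgeo : ∀ x y : X, ∃ γ : ℝ → X, γ 0 = x ∧ γ 1 = y ∧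
      ∀ s ∈ Icc (0:ℝ) 1, ∀ t ∈ Icc (0:ℝ) 1, dist (γ s) (γ t) = |s - t| * dist x y)
    (hmid : ∀ x y : X, ∃ m, dist x m = dist x y / 2 ∧ dist m y = dist x y / 2 ∧
      2 * f m ≤ f x + f y)
    (x y : X) :
    ∃ γ : ℝ → X, γ 0 = x ∧ γ 1 = y ∧
      (∀ s ∈ Icc (0:ℝ) 1, ∀ t ∈ Icc (0:ℝ) 1, dist (γ s) (γ t) = |s - t| * dist x y) ∧
      ConvexOn ℝ (Icc 0 1) (fun s => f (γ s)) := by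
  choose c hc0 hcN hdist hconv using fun n : ℕ =>
    exists_convex_chain hf hgeo hmid x y n.succ_pos
  let U : Ultrafilter ℕ := hyperfilter ℕ
  have hU : (U : Filter ℕ) ≤ atTop := Nat.hyperfilter_le_atTop
  let u : ℕ → ℝ → ℕ := fun n s => ⌊s * ((n + 1 : ℕ) : ℝ)⌋₊
  have hule : ∀ n, ∀ s ∈ Icc (0 : ℝ) 1, u n s ≤ n + 1 := fun n s hs =>
    Nat.floor_le_of_le (mul_le_of_le_one_left (by positivity) hs.2)
  have hulim : ∀ s ∈ Icc (0 : ℝ) 1,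
      Tendsto (fun n => (u n s : ℝ) / ((n + 1 : ℕ) : ℝ)) U (nhds s) := fun s hs =>
    ((tendsto_nat_floor_mul_div_atTop hs.1).comp
      (tendsto_natCast_atTop_atTop.comp (tendsto_add_atTop_nat 1))).mono_left hU
  obtain ⟨γ, hγ⟩ := exists_pointwise_limit U (fun n s => c n (u n s)) (S := Icc (0 : ℝ) 1) x (by
    intro s hs
    refine ⟨dist x y, Eventually.of_forall fun n => ?_⟩
    have h1 := hdist n (u n s) (hule n s hs) 0 (by omega)
    have h2 : (u n s : ℝ) ≤ ((n + 1 : ℕ) : ℝ) := by exact_mod_cast hule n s hs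
    rw [hc0, Nat.cast_zero, sub_zero, Nat.abs_cast] at h1
    rw [h1, mul_div_left_comm]
    exact mul_le_of_le_one_right dist_nonneg ((div_le_one (by positivity)).2 h2))
  have hfγ : ∀ s ∈ Icc (0 : ℝ) 1, Tendsto (fun n => f (c n (u n s))) U (nhds (f (γ s))) :=
    fun s hs => (hf.tendsto _).comp (hγ s hs)
  refine ⟨γ, ?_, ?_, fun s hs t ht => ?_, ?_⟩
  · refine tendsto_nhds_unique (hγ 0 (by simp)) (tendsto_const_nhds.congr fun n => ?_)
    simp [u, hc0]
  · refine tendsto_nhds_unique (hγ 1 (by simp)) (tendsto_const_nhds.congr fun n => ?_)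
    simp only [u, one_mul, Nat.floor_natCast]
    exact (hcN n).symm
  · refine tendsto_nhds_unique ((hγ s hs).dist (hγ t ht))
      ((((hulim s hs).sub (hulim t ht)).abs.mul_const (dist x y)).congr fun n => ?_)
    rw [hdist n _ (hule n s hs) _ (hule n t ht), ← sub_div, abs_div, Nat.abs_cast]
    simp only [Nat.succ_eq_add_one]
    ring
  · refine convexOn_of_slope_mono_adjacent (convex_Icc 0 1) fun {r s t} hr ht hrs hst => ?_
    have hs : s ∈ Icc (0 : ℝ) 1 := ⟨hr.1.trans hrs.le, hst.le.trans ht.2⟩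
    rw [div_le_div_iff₀ (sub_pos.2 hrs) (sub_pos.2 hst)]
    refine le_of_tendsto_of_tendsto'
      (((hfγ s hs).sub (hfγ r hr)).mul ((hulim t ht).sub (hulim s hs)))
      (((hfγ t ht).sub (hfγ s hs)).mul ((hulim s hs).sub (hulim r hr))) fun n => ?_
    have hmono : Monotone (u n) := fun a b hab =>
      Nat.floor_mono (mul_le_mul_of_nonneg_right hab (by positivity))
    have key := slope_mono_of_second_difference_nonneg (a := fun i => f (c n i)) (hconv n)
      (hmono hrs.le) (hmono hst.le) (hule n t ht)
    rw [← sub_div, ← sub_div, ← mul_div_assoc, ← mul_div_assoc]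
    exact div_le_div_of_nonneg_right key (by positivity)

/-- In a hyperbolic space, a geodesic `ξ` ending at the point `ζ n` of a ray from `p` fellow-travels
that ray, provided its initial point `ξ 0` is near `p` and its length is at most `n`. -/
lemma dist_ray_le {X : Type*} [MetricSpace X] {δ : ℝ}
    (hhyp : ∀ p x y z : X,
      gromovProduct p x z ≥ min (gromovProduct p x y) (gromovProduct p y z) - δ)
    {p m q a z : X} {K n ℓ t : ℝ} (hK : 0 ≤ K) (hpm : dist p m ≤ K) (hmq : dist m q = t)
    (hqa : dist q a = ℓ - t) (hℓ : ℓ ≤ n) (hpz : dist p z = t) (hza : dist z a = n - t)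
    (hpa : dist p a = n) : dist q z ≤ 2 * K + 2 * δ := by
  have h := hhyp p q a z
  have h1 := dist_triangle p m q
  have h2 := dist_triangle m p q
  rw [dist_comm m p] at h2
  simp only [gromovProduct, dist_comm a z, hpa, hpz, hza, hqa] at h
  rcases min_choice ((dist p q + n - (ℓ - t)) / 2) ((n + t - (n - t)) / 2) with h3 | h3 <;>
    rw [h3] at h <;> linarith

/-- In a proper, geodesic `δ`-hyperbolic space with an `L`-Lipschitz convex function `f`,
given two rays `ζ₁, ζ₂` from a common point `p` representing distinct boundary points, there
is a unit-speed geodesic line `ξ : ℝ → X` along which `f` is convex, whose negative half is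
asymptotic to `ζ₁` and whose positive half is asymptotic to `ζ₂`. -/
theorem exists_bridging_line
    {X : Type*} [MetricSpace X] [ProperSpace X] (δ : ℝ) (hδ : 0 ≤ δ)
    (hgeo : ∀ x y : X, ∃ γ : ℝ → X, γ 0 = x ∧ γ 1 = y ∧
      ∀ s ∈ Icc (0:ℝ) 1, ∀ t ∈ Icc (0:ℝ) 1, dist (γ s) (γ t) = |s - t| * dist x y)
    (hhyp : ∀ p x y z : X,
      gromovProduct p x z ≥ min (gromovProduct p x y) (gromovProduct p y z) - δ)
    (L : ℝ) (hL : 0 < L) (f : X → ℝ)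
    (hf : ∀ x y : X, |f x - f y| ≤ L * dist x y)
    (hconv : ∀ x y : X, ∃ γ : ℝ → X, γ 0 = x ∧ γ 1 = y ∧
      (∀ s ∈ Icc (0:ℝ) 1, ∀ t ∈ Icc (0:ℝ) 1, dist (γ s) (γ t) = |s - t| * dist x y) ∧
      ∀ s ∈ Icc (0:ℝ) 1, f (γ s) ≤ (1 - s) * f x + s * f y)
    (p : X) (ζ₁ ζ₂ : ℝ → X)
    (hζ₁ : ∀ s ∈ Ici (0:ℝ), ∀ t ∈ Ici (0:ℝ), dist (ζ₁ s) (ζ₁ t) = |s - t|)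
    (hζ₂ : ∀ s ∈ Ici (0:ℝ), ∀ t ∈ Ici (0:ℝ), dist (ζ₂ s) (ζ₂ t) = |s - t|)
    (hp₁ : ζ₁ 0 = p) (hp₂ : ζ₂ 0 = p)
    (hnotasym : ¬ ∃ C : ℝ, ∀ t ≥ (0:ℝ), dist (ζ₁ t) (ζ₂ t) ≤ C)
    (hgromov : ∃ C : ℝ, ∀ t > (0:ℝ), gromovProduct p (ζ₁ t) (ζ₂ t) ≤ C) :
    ∃ ξ : ℝ → X,
      (∀ s t : ℝ, dist (ξ s) (ξ t) = |s - t|) ∧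
      ConvexOn ℝ Set.univ (fun t => f (ξ t)) ∧
      (∃ C : ℝ, ∀ t ≥ (0:ℝ), dist (ξ (-t)) (ζ₁ t) ≤ C) ∧
      (∃ C : ℝ, ∀ t ≥ (0:ℝ), dist (ξ t) (ζ₂ t) ≤ C) := by
  have hfc : Continuous f := by
    refine (LipschitzWith.of_dist_le_mul (K := L.toNNReal) fun x y => ?_).continuous
    rw [Real.coe_toNNReal _ hL.le, Real.dist_eq]
    exact hf x y
  have hmid : ∀ x y : X, ∃ m, dist x m = dist x y / 2 ∧ dist m y = dist x y / 2 ∧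
      2 * f m ≤ f x + f y := by
    intro x y
    obtain ⟨γ, h0, h1, hd, hc⟩ := hconv x y
    have hmem : (1 / 2 : ℝ) ∈ Icc (0 : ℝ) 1 := by norm_num
    refine ⟨γ (1 / 2), ?_, ?_, ?_⟩
    · have := hd 0 (by simp) _ hmem
      rw [h0] at this
      rw [this]
      norm_num [abs_of_pos]
      ring
    · have := hd _ hmem 1 (by simp)
      rw [h1] at this
      rw [this]
      norm_num [abs_of_pos]
      ring
    · linarith [hc _ hmem]
  obtain ⟨C, hC⟩ := hgromov
  choose γ hγ0 hγ1 hγd hγc using fun n : ℕ =>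
    exists_convexOn_geodesic hfc hgeo hmid (ζ₁ n) (ζ₂ n)
  let D : ℕ → ℝ := fun n => dist (ζ₁ n) (ζ₂ n)
  have hp1 : ∀ t : ℝ, 0 ≤ t → dist p (ζ₁ t) = t := fun t ht => by
    rw [← hp₁, hζ₁ 0 (by simp) t ht, zero_sub, abs_neg, abs_of_nonneg ht]
  have hp2 : ∀ t : ℝ, 0 ≤ t → dist p (ζ₂ t) = t := fun t ht => by
    rw [← hp₂, hζ₂ 0 (by simp) t ht, zero_sub, abs_neg, abs_of_nonneg ht]
  have hDle : ∀ n, D n / 2 ≤ n := fun n => by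
    have h := dist_triangle_left (ζ₁ n) (ζ₂ n) p
    rw [hp1 n n.cast_nonneg, hp2 n n.cast_nonneg] at h
    change dist (ζ₁ n) (ζ₂ n) / 2 ≤ n
    linarith
  have hDge : ∀ n : ℕ, 0 < n → 2 * (n : ℝ) - 2 * C ≤ D n := fun n hn => by
    have h := hC n (by exact_mod_cast hn)
    rw [gromovProduct, hp1 n n.cast_nonneg, hp2 n n.cast_nonneg] at h
    change _ ≤ dist (ζ₁ n) (ζ₂ n)
    linarith
  let g : ℕ → ℝ → X := fun n t => γ n (1 / 2 + t / D n)
  let U : Ultrafilter ℕ := hyperfilter ℕ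
  have hU : (U : Filter ℕ) ≤ atTop := Nat.hyperfilter_le_atTop
  have hlarge : ∀ t : ℝ, ∀ᶠ n : ℕ in U, 0 < n ∧ 0 < D n ∧ |t| ≤ D n / 2 := by
    intro t
    filter_upwards [hU (eventually_gt_atTop 0),
      hU (tendsto_natCast_atTop_atTop.eventually_ge_atTop (C + |t| + 1))] with n hn hn'
    have := hDge n hn
    have := abs_nonneg t
    exact ⟨hn, by linarith, by linarith⟩
  have hmem : ∀ n t, 0 < D n → |t| ≤ D n / 2 → 1 / 2 + t / D n ∈ Icc (0 : ℝ) 1 := by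
    intro n t hD ht
    rw [abs_le] at ht
    have h1 : -(1 / 2) ≤ t / D n := by rw [le_div_iff₀ hD]; linarith
    have h2 : t / D n ≤ 1 / 2 := by rw [div_le_iff₀ hD]; linarith
    constructor <;> linarith
  have hgd : ∀ n s t, 0 < D n → |s| ≤ D n / 2 → |t| ≤ D n / 2 →
      dist (g n s) (g n t) = |s - t| := by
    intro n s t hD hs ht
    refine (hγd n _ (hmem n s hD hs) _ (hmem n t hD ht)).trans ?_
    change _ * D n = _
    rw [add_sub_add_left_eq_sub, ← sub_div, abs_div, abs_of_pos hD, div_mul_cancel₀ _ hD.ne']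
  have hg1 : ∀ n, 0 < D n → g n (-(D n / 2)) = ζ₁ n := fun n hD => by
    rw [← hγ0 n]
    simp only [g]
    congr 1
    field_simp
    ring
  have hg2 : ∀ n, 0 < D n → g n (D n / 2) = ζ₂ n := fun n hD => by
    rw [← hγ1 n]
    simp only [g]
    congr 1
    field_simp
    ring
  have hgd1 : ∀ n t, 0 < D n → |t| ≤ D n / 2 → dist (g n t) (ζ₁ n) = D n / 2 + t := by
    intro n t hD ht
    rw [← hg1 n hD, hgd n _ _ hD ht (by rw [abs_neg, abs_of_pos (half_pos hD)]), abs_of_nonneg]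
    · ring
    · linarith [(abs_le.1 ht).1]
  have hgd2 : ∀ n t, 0 < D n → |t| ≤ D n / 2 → dist (g n t) (ζ₂ n) = D n / 2 - t := by
    intro n t hD ht
    rw [← hg2 n hD, hgd n _ _ hD ht (by rw [abs_of_pos (half_pos hD)]), abs_of_nonpos]
    · ring
    · linarith [(abs_le.1 ht).2]
  have hbase : ∀ n, 0 < n → 0 < D n → dist p (g n 0) ≤ 2 * (C + δ) := by
    intro n hn hD
    have h0 : |(0 : ℝ)| ≤ D n / 2 := by rw [abs_zero]; positivity
    have h1 := hgd1 n 0 hD h0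
    have h2 := hgd2 n 0 hD h0
    have h := hhyp p (ζ₁ n) (g n 0) (ζ₂ n)
    have h3 := hC n (by exact_mod_cast hn)
    have h4 := hDle n
    have h5 : gromovProduct p (ζ₁ n) (g n 0) = (n + dist p (g n 0) - D n / 2) / 2 := by
      rw [gromovProduct, dist_comm (ζ₁ n) (g n 0), h1, hp1 n n.cast_nonneg, add_zero]
    have h6 : gromovProduct p (g n 0) (ζ₂ n) = (n + dist p (g n 0) - D n / 2) / 2 := by
      rw [gromovProduct, h2, hp2 n n.cast_nonneg]
      ring
    rw [h5, h6, min_self] at h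
    linarith
  obtain ⟨ξ, hξ⟩ := exists_pointwise_limit U g (S := univ) p (by
    intro t _
    refine ⟨2 * (C + δ) + |t|, ?_⟩
    filter_upwards [hlarge t] with n ⟨hn, hD, ht⟩
    have h1 := hgd n t 0 hD ht (by rw [abs_zero]; positivity)
    have h2 := dist_triangle_right (g n t) p (g n 0)
    rw [sub_zero] at h1
    linarith [hbase n hn hD])
  have hξ := fun t => hξ t (mem_univ t)
  have hK : 0 ≤ 2 * (C + δ) := by
    obtain ⟨n, hn, hD, -⟩ := (hlarge 0).exists
    exact dist_nonneg.trans (hbase n hn hD)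
  refine ⟨ξ, fun s t => ?_, ⟨convex_univ, fun s _ t _ a b ha hb hab => ?_⟩,
    ⟨2 * (2 * (C + δ)) + 2 * δ, fun t ht => ?_⟩, ⟨2 * (2 * (C + δ)) + 2 * δ, fun t ht => ?_⟩⟩
  · refine tendsto_nhds_unique ((hξ s).dist (hξ t)) (tendsto_const_nhds.congr' ?_)
    filter_upwards [hlarge s, hlarge t] with n ⟨_, hD, hs⟩ ⟨_, _, ht⟩
    exact (hgd n s t hD hs ht).symm
  · have hfξ : ∀ t, Tendsto (fun n => f (g n t)) U (nhds (f (ξ t))) :=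
      fun t => (hfc.tendsto _).comp (hξ t)
    refine le_of_tendsto_of_tendsto (hfξ _) (((hfξ s).const_smul a).add ((hfξ t).const_smul b)) ?_
    filter_upwards [hlarge s, hlarge t] with n ⟨_, hD, hs⟩ ⟨_, _, ht⟩
    have h := (hγc n).2 (hmem n s hD hs) (hmem n t hD ht) ha hb hab
    have e : 1 / 2 + (a • s + b • t) / D n
        = a • (1 / 2 + s / D n) + b • (1 / 2 + t / D n) := by
      simp only [smul_eq_mul]
      linear_combination (-(1 / 2) : ℝ) * hab
    simp only [g]
    rw [e]
    exact h
  · refine le_of_tendsto ((hξ (-t)).dist tendsto_const_nhds) ?_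
    filter_upwards [hlarge t] with n ⟨hn, hD, htD⟩
    have htn : t ≤ n := (le_abs_self t).trans (htD.trans (hDle n))
    have htD' : |-t| ≤ D n / 2 := by rwa [abs_neg]
    refine dist_ray_le hhyp hK (hbase n hn hD) ?_ (hgd1 n (-t) hD htD') (hDle n) (hp1 t ht) ?_
      (hp1 n n.cast_nonneg)
    · rw [hgd n 0 (-t) hD (by rw [abs_zero]; positivity) htD', sub_neg_eq_add, zero_add,
        abs_of_nonneg ht]
    · rw [hζ₁ t ht n (mem_Ici.2 n.cast_nonneg), abs_of_nonpos (by linarith)]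
      ring
  · refine le_of_tendsto ((hξ t).dist tendsto_const_nhds) ?_
    filter_upwards [hlarge t] with n ⟨hn, hD, htD⟩
    have htn : t ≤ n := (le_abs_self t).trans (htD.trans (hDle n))
    refine dist_ray_le hhyp hK (hbase n hn hD) ?_ (hgd2 n t hD htD) (hDle n) (hp2 t ht) ?_
      (hp2 n n.cast_nonneg)
    · rw [hgd n 0 t hD (by rw [abs_zero]; positivity) htD, zero_sub, abs_neg, abs_of_nonneg ht]
    · rw [hζ₂ t ht n (mem_Ici.2 n.cast_nonneg), abs_of_nonpos (by linarith)]
      ring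
end

section
/- Let (X,d) be a proper, geodesic δ-hyperbolic metric space and f : X → ℝ an L-Lipschitz convex function. Then for every x ∈ X and every ray ξ : [0,∞) → X with f∘ξ convex, the descending slope satisfies |∇⁻f|(x) ≥ −lim_{t→∞} f(ξ(t))/t. In particular, inf_{x∈X} |∇⁻f|(x) ≥ sup_ξ ( −lim_{t→∞} f(ξ(t))/t ), the supremum taken over all rays ξ with f∘ξ convex (weak duality). -/
open Set Filter

/-- The descending slope `|∇⁻f|(x) = limsup_{y→x} max{f(x)−f(y),0} / d(x,y)`. -/
noncomputable def descSlope {X : Type*} [MetricSpace X] (f : X → ℝ) (x : X) : ℝ :=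
  Filter.limsup (fun y => max (f x - f y) 0 / dist x y) (nhdsWithin x {x}ᶜ)

/-- A global Lipschitz bound makes the difference quotients of the descending slope bounded, so
the slope dominates every lower bound that is attained frequently near the base point. -/
lemma le_descSlope_of_frequently {X : Type*} [MetricSpace X] {f : X → ℝ} {L : ℝ} (hL : 0 ≤ L)
    (hf : ∀ x y : X, |f x - f y| ≤ L * dist x y) {x : X} {c : ℝ}
    (hc : ∃ᶠ y in nhdsWithin x {x}ᶜ, c ≤ max (f x - f y) 0 / dist x y) :
    c ≤ descSlope f x := by
  refine le_limsup_of_frequently_le hc (isBoundedUnder_of ⟨L, fun y => ?_⟩)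
  exact div_le_of_le_mul₀ dist_nonneg hL
    (max_le ((le_abs_self _).trans (hf x y)) (by positivity))

/-- If `f` lies below its chord along some geodesic from `x` to `y`, the descending slope at `x`
is at least the mean rate of decrease of `f` from `x` to `y`. -/
lemma div_dist_le_descSlope {X : Type*} [MetricSpace X] {f : X → ℝ} {L : ℝ} (hL : 0 ≤ L)
    (hf : ∀ x y : X, |f x - f y| ≤ L * dist x y) {x y : X} (hxy : 0 < dist x y) {γ : ℝ → X}
    (hγ0 : γ 0 = x)
    (hγ : ∀ s ∈ Icc (0 : ℝ) 1, ∀ t ∈ Icc (0 : ℝ) 1, dist (γ s) (γ t) = |s - t| * dist x y)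
    (hfγ : ∀ s ∈ Icc (0 : ℝ) 1, f (γ s) ≤ (1 - s) * f x + s * f y) :
    (f x - f y) / dist x y ≤ descSlope f x := by
  have hdist : ∀ s ∈ Ioo (0 : ℝ) 1, dist x (γ s) = s * dist x y := fun s hs => by
    have h := hγ 0 (by simp) s (Ioo_subset_Icc_self hs)
    rwa [hγ0, zero_sub, abs_neg, abs_of_pos hs.1] at h
  have hnear : ∀ᶠ s in nhdsWithin (0 : ℝ) (Ioi 0), s ∈ Ioo (0 : ℝ) 1 :=
    Ioo_mem_nhdsGT one_pos
  have htend : Tendsto γ (nhdsWithin 0 (Ioi 0)) (nhdsWithin x {x}ᶜ) := by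
    refine tendsto_nhdsWithin_iff.2 ⟨?_, ?_⟩
    · rw [tendsto_iff_dist_tendsto_zero]
      have h : Tendsto (fun s : ℝ => s * dist x y) (nhdsWithin 0 (Ioi 0)) (nhds 0) := by
        have h' : Continuous fun s : ℝ => s * dist x y := by fun_prop
        simpa using (h'.tendsto 0).mono_left nhdsWithin_le_nhds
      refine h.congr' ?_
      filter_upwards [hnear] with s hs
      rw [dist_comm (γ s) x, hdist s hs]
    · filter_upwards [hnear] with s hs
      have hpos : 0 < dist x (γ s) := by
        rw [hdist s hs]
        exact mul_pos hs.1 hxy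
      exact (dist_pos.1 hpos).symm
  refine le_descSlope_of_frequently hL hf (htend.frequently (Eventually.frequently ?_))
  filter_upwards [hnear] with s hs
  rw [hdist s hs, ← mul_div_mul_left (f x - f y) (dist x y) hs.1.ne']
  have hs0 := hs.1
  gcongr
  refine le_max_of_le_left ?_
  linarith [hfγ s (Ioo_subset_Icc_self hs)]

/-- The mean rate of decrease of `f` from a fixed point to the points of a ray converges to minus
the asymptotic slope of `f` along the ray. -/
lemma tendsto_sub_div_dist_ray {X : Type*} [MetricSpace X] {f : X → ℝ} (x : X) {ξ : ℝ → X}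
    (hξ : ∀ s ∈ Ici (0 : ℝ), ∀ t ∈ Ici (0 : ℝ), dist (ξ s) (ξ t) = |s - t|) {a : ℝ}
    (ha : Tendsto (fun t => f (ξ t) / t) atTop (nhds a)) :
    Tendsto (fun t => (f x - f (ξ t)) / dist x (ξ t)) atTop (nhds (-a)) := by
  have hinv (c : ℝ) : Tendsto (fun t : ℝ => c / t) atTop (nhds 0) :=
    tendsto_const_nhds.div_atTop tendsto_id
  have hratio : Tendsto (fun t => dist x (ξ t) / t) atTop (nhds 1) := by
    have hlow := (tendsto_const_nhds (x := (1 : ℝ))).sub (hinv (dist x (ξ 0)))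
    have hupp := (tendsto_const_nhds (x := (1 : ℝ))).add (hinv (dist x (ξ 0)))
    rw [sub_zero] at hlow
    rw [add_zero] at hupp
    have hray : ∀ t : ℝ, 0 < t → dist (ξ 0) (ξ t) = t := fun t ht => by
      rw [hξ 0 self_mem_Ici t ht.le, zero_sub, abs_neg, abs_of_pos ht]
    refine tendsto_of_tendsto_of_tendsto_of_le_of_le' hlow hupp ?_ ?_
    · filter_upwards [eventually_gt_atTop 0] with t ht
      rw [one_sub_div ht.ne']
      gcongr
      linarith [hray t ht, dist_triangle_left (ξ 0) (ξ t) x]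
    · filter_upwards [eventually_gt_atTop 0] with t ht
      rw [one_add_div ht.ne']
      gcongr
      linarith [hray t ht, dist_triangle x (ξ 0) (ξ t)]
  have h := ((hinv (f x)).sub ha).div hratio one_ne_zero
  rw [zero_sub, div_one] at h
  refine h.congr' ?_
  filter_upwards [eventually_gt_atTop 0] with t ht
  rw [Pi.div_apply, ← sub_div, div_div_div_cancel_right₀ ht.ne']

/-- Weak duality: in a proper, geodesic `δ`-hyperbolic space, the descending slope of an
`L`-Lipschitz convex function `f` at any point is at least minus the asymptotic slope along
any ray on which `f` is convex; in particular, `inf_x |∇⁻f|(x)` dominates `−a` for every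
such asymptotic slope `a`. -/
theorem weak_duality
    {X : Type*} [MetricSpace X] [ProperSpace X] (δ : ℝ) (hδ : 0 ≤ δ)
    (hgeo : ∀ x y : X, ∃ γ : ℝ → X, γ 0 = x ∧ γ 1 = y ∧
      ∀ s ∈ Icc (0:ℝ) 1, ∀ t ∈ Icc (0:ℝ) 1, dist (γ s) (γ t) = |s - t| * dist x y)
    (hhyp : ∀ p x y z : X,
      gromovProduct p x z ≥ min (gromovProduct p x y) (gromovProduct p y z) - δ)
    (L : ℝ) (hL : 0 < L) (f : X → ℝ)
    (hf : ∀ x y : X, |f x - f y| ≤ L * dist x y)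
    (hconv : ∀ x y : X, ∃ γ : ℝ → X, γ 0 = x ∧ γ 1 = y ∧
      (∀ s ∈ Icc (0:ℝ) 1, ∀ t ∈ Icc (0:ℝ) 1, dist (γ s) (γ t) = |s - t| * dist x y) ∧
      ∀ s ∈ Icc (0:ℝ) 1, f (γ s) ≤ (1 - s) * f x + s * f y) :
    (∀ x : X, ∀ ξ : ℝ → X,
      (∀ s ∈ Ici (0:ℝ), ∀ t ∈ Ici (0:ℝ), dist (ξ s) (ξ t) = |s - t|) →
      ConvexOn ℝ (Ici (0:ℝ)) (fun t => f (ξ t)) →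
      ∀ a : ℝ, Tendsto (fun t => f (ξ t) / t) atTop (nhds a) →
        -a ≤ descSlope f x) ∧
    (∀ ξ : ℝ → X,
      (∀ s ∈ Ici (0:ℝ), ∀ t ∈ Ici (0:ℝ), dist (ξ s) (ξ t) = |s - t|) →
      ConvexOn ℝ (Ici (0:ℝ)) (fun t => f (ξ t)) →
      ∀ a : ℝ, Tendsto (fun t => f (ξ t) / t) atTop (nhds a) →
        -a ≤ ⨅ x : X, descSlope f x) := by
  have main : ∀ x : X, ∀ ξ : ℝ → X,
      (∀ s ∈ Ici (0:ℝ), ∀ t ∈ Ici (0:ℝ), dist (ξ s) (ξ t) = |s - t|) →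
      ∀ a : ℝ, Tendsto (fun t => f (ξ t) / t) atTop (nhds a) → -a ≤ descSlope f x := by
    intro x ξ hξ a ha
    refine le_of_tendsto (tendsto_sub_div_dist_ray x hξ ha) ?_
    filter_upwards [eventually_gt_atTop (dist x (ξ 0)), eventually_ge_atTop 0] with t ht ht0
    have hray : dist (ξ 0) (ξ t) = t := by
      rw [hξ 0 self_mem_Ici t ht0, zero_sub, abs_neg, abs_of_nonneg ht0]
    have hpos : 0 < dist x (ξ t) := by
      linarith [dist_triangle_left (ξ 0) (ξ t) x]
    obtain ⟨γ, hγ0, -, hγ, hfγ⟩ := hconv x (ξ t)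
    exact div_dist_le_descSlope hL.le hf hpos hγ0 hγ hfγ
  refine ⟨fun x ξ hξ _ a ha => main x ξ hξ a ha, fun ξ hξ _ a ha => ?_⟩
  have : Nonempty X := ⟨ξ 0⟩
  exact le_ciInf fun x => main x ξ hξ a ha
end

section
/- Let (X,d) be a proper, geodesic δ-hyperbolic metric space and f : X → ℝ an L-Lipschitz convex function. If ξ₁, ξ₂ : [0,∞) → X are rays with f∘ξ₁ and f∘ξ₂ convex and lim_{t→∞} f(ξ₁(t))/t < 0 and lim_{t→∞} f(ξ₂(t))/t < 0, then ξ₁ and ξ₂ are asymptotic, i.e., sup_{t≥0} d(ξ₁(t),ξ₂(t)) < ∞. (Uniqueness of the direction of negative asymptotic slope in the Gromov boundary.) -/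
open Set Filter

/-- A geodesic from `x` to `y` in a hyperbolic space contains a point whose distance to `p` is
at most `(x|y)_p + 2δ`. -/
theorem exists_dist_le_gromovProduct_add {X : Type*} [MetricSpace X] {δ : ℝ}
    (hhyp : ∀ p x y z : X,
      gromovProduct p x z ≥ min (gromovProduct p x y) (gromovProduct p y z) - δ)
    (p : X) {x y : X} {γ : ℝ → X} (h₀ : γ 0 = x) (h₁ : γ 1 = y)
    (hγ : ∀ s ∈ Icc (0:ℝ) 1, ∀ t ∈ Icc (0:ℝ) 1, dist (γ s) (γ t) = |s - t| * dist x y) :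
    ∃ s ∈ Icc (0:ℝ) 1, dist p (γ s) ≤ gromovProduct p x y + 2 * δ := by
  have hxy := dist_triangle p x y
  have hyx := dist_triangle_right p x y
  have hpxy := dist_triangle_left x y p
  obtain ⟨s, hs, hsd⟩ : ∃ s ∈ Icc (0:ℝ) 1,
      s * dist x y = dist p x - gromovProduct p x y := by
    rcases (dist_nonneg (x := x) (y := y)).eq_or_lt with h | h
    · refine ⟨0, by simp, ?_⟩
      unfold gromovProduct
      linarith
    · refine ⟨(dist p x - gromovProduct p x y) / dist x y, ⟨?_, ?_⟩, ?_⟩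
      · apply div_nonneg _ h.le
        unfold gromovProduct
        linarith
      · rw [div_le_one h]
        unfold gromovProduct
        linarith
      · field_simp
  refine ⟨s, hs, ?_⟩
  have hx : dist x (γ s) = s * dist x y := by
    rw [← h₀, hγ 0 (by simp) s hs, h₀, zero_sub, abs_neg, abs_of_nonneg hs.1]
  have hy : dist (γ s) y = (1 - s) * dist x y := by
    rw [← h₁, hγ s hs 1 (by simp), h₁, abs_sub_comm, abs_of_nonneg (by linarith [hs.2])]
  have h := hhyp p x (γ s) y
  unfold gromovProduct at *
  rcases min_choice ((dist p x + dist p (γ s) - dist x (γ s)) / 2)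
    ((dist p (γ s) + dist p y - dist (γ s) y) / 2) with h' | h' <;> rw [h'] at h <;> linarith

/-- A function of negative asymptotic slope tends to `-∞`. -/
theorem tendsto_atBot_of_div_tendsto_neg {g : ℝ → ℝ} {a : ℝ}
    (h : Tendsto (fun t => g t / t) atTop (nhds a)) (ha : a < 0) :
    Tendsto g atTop atBot := by
  refine (h.neg_mul_atTop ha tendsto_id).congr' ?_
  filter_upwards [eventually_ne_atTop 0] with t ht
  simp [ht]

/-- Uniqueness of the direction of negative asymptotic slope: in a proper, geodesic
`δ`-hyperbolic space, any two rays along which the `L`-Lipschitz convex function `f` is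
convex and has negative asymptotic slope are asymptotic to each other. -/
theorem uniqueness_negative_direction
    {X : Type*} [MetricSpace X] [ProperSpace X] (δ : ℝ) (hδ : 0 ≤ δ)
    (hgeo : ∀ x y : X, ∃ γ : ℝ → X, γ 0 = x ∧ γ 1 = y ∧
      ∀ s ∈ Icc (0:ℝ) 1, ∀ t ∈ Icc (0:ℝ) 1, dist (γ s) (γ t) = |s - t| * dist x y)
    (hhyp : ∀ p x y z : X,
      gromovProduct p x z ≥ min (gromovProduct p x y) (gromovProduct p y z) - δ)
    (L : ℝ) (hL : 0 < L) (f : X → ℝ)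
    (hf : ∀ x y : X, |f x - f y| ≤ L * dist x y)
    (hconv : ∀ x y : X, ∃ γ : ℝ → X, γ 0 = x ∧ γ 1 = y ∧
      (∀ s ∈ Icc (0:ℝ) 1, ∀ t ∈ Icc (0:ℝ) 1, dist (γ s) (γ t) = |s - t| * dist x y) ∧
      ∀ s ∈ Icc (0:ℝ) 1, f (γ s) ≤ (1 - s) * f x + s * f y)
    (ξ₁ ξ₂ : ℝ → X)
    (hξ₁ : ∀ s ∈ Ici (0:ℝ), ∀ t ∈ Ici (0:ℝ), dist (ξ₁ s) (ξ₁ t) = |s - t|)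
    (hξ₂ : ∀ s ∈ Ici (0:ℝ), ∀ t ∈ Ici (0:ℝ), dist (ξ₂ s) (ξ₂ t) = |s - t|)
    (hconv₁ : ConvexOn ℝ (Ici (0:ℝ)) (fun t => f (ξ₁ t)))
    (hconv₂ : ConvexOn ℝ (Ici (0:ℝ)) (fun t => f (ξ₂ t)))
    (a₁ a₂ : ℝ)
    (ha₁ : Tendsto (fun t => f (ξ₁ t) / t) atTop (nhds a₁)) (ha₁neg : a₁ < 0)
    (ha₂ : Tendsto (fun t => f (ξ₂ t) / t) atTop (nhds a₂)) (ha₂neg : a₂ < 0) :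
    ∃ C : ℝ, ∀ t ≥ (0:ℝ), dist (ξ₁ t) (ξ₂ t) ≤ C := by
  refine ⟨3 * dist (ξ₁ 0) (ξ₂ 0) + 4 * δ, fun t ht => ?_⟩
  obtain ⟨T, ⟨hT₁, hT₂⟩, hT⟩ :=
    ((((tendsto_atBot_of_div_tendsto_neg ha₁ ha₁neg).eventually_le_atBot
      (f (ξ₁ 0) - L * (t + 2 * δ))).and
      ((tendsto_atBot_of_div_tendsto_neg ha₂ ha₂neg).eventually_le_atBot
      (f (ξ₁ 0) - L * (t + 2 * δ)))).and (eventually_ge_atTop t)).exists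
  have hT0 : 0 ≤ T := ht.trans hT
  obtain ⟨γ, h₀, h₁, hγ, hfγ⟩ := hconv (ξ₁ T) (ξ₂ T)
  obtain ⟨s, hs, hsp⟩ := exists_dist_le_gromovProduct_add hhyp (ξ₁ 0) h₀ h₁ hγ
  have hfs : f (γ s) ≤ f (ξ₁ 0) - L * (t + 2 * δ) := by
    have h := hfγ s hs
    have h₁ := mul_le_mul_of_nonneg_left hT₁ (sub_nonneg.2 hs.2)
    have h₂ := mul_le_mul_of_nonneg_left hT₂ hs.1
    linarith
  have hfar : t + 2 * δ ≤ dist (ξ₁ 0) (γ s) := by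
    refine le_of_mul_le_mul_left ?_ hL
    linarith [(le_abs_self _).trans (hf (ξ₁ 0) (γ s))]
  have hg : t ≤ gromovProduct (ξ₁ 0) (ξ₁ T) (ξ₂ T) := by linarith
  have d₁ (u : ℝ) (hu : 0 ≤ u) : dist (ξ₁ 0) (ξ₁ u) = u := by
    rw [hξ₁ 0 (by simp) u hu, zero_sub, abs_neg, abs_of_nonneg hu]
  have d₂ (u : ℝ) (hu : 0 ≤ u) : dist (ξ₂ 0) (ξ₂ u) = u := by
    rw [hξ₂ 0 (by simp) u hu, zero_sub, abs_neg, abs_of_nonneg hu]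
  have e₁ : dist (ξ₁ t) (ξ₁ T) = T - t := by
    rw [hξ₁ t ht T hT0, abs_sub_comm, abs_of_nonneg (sub_nonneg.2 hT)]
  have e₂ : dist (ξ₂ T) (ξ₂ t) = T - t := by
    rw [hξ₂ T hT0 t ht, abs_of_nonneg (sub_nonneg.2 hT)]
  have l₁ := dist_triangle_left (ξ₂ 0) (ξ₂ t) (ξ₁ 0)
  have l₂ := dist_triangle_left (ξ₂ 0) (ξ₂ T) (ξ₁ 0)
  have l₃ := dist_triangle (ξ₁ 0) (ξ₂ 0) (ξ₂ t)
  have hD : 0 ≤ dist (ξ₁ 0) (ξ₂ 0) := dist_nonneg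
  have hg₁ : gromovProduct (ξ₁ 0) (ξ₁ t) (ξ₁ T) = t := by
    rw [gromovProduct, d₁ t ht, d₁ T hT0, e₁]
    ring
  have hg₂ : t - dist (ξ₁ 0) (ξ₂ 0) ≤ gromovProduct (ξ₁ 0) (ξ₂ T) (ξ₂ t) := by
    rw [gromovProduct, e₂]
    linarith [d₂ t ht, d₂ T hT0]
  have hg₃ : t - dist (ξ₁ 0) (ξ₂ 0) - δ ≤ gromovProduct (ξ₁ 0) (ξ₁ T) (ξ₂ t) := by
    have hmin : t - dist (ξ₁ 0) (ξ₂ 0) ≤ min (gromovProduct (ξ₁ 0) (ξ₁ T) (ξ₂ T))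
        (gromovProduct (ξ₁ 0) (ξ₂ T) (ξ₂ t)) := le_min (by linarith) hg₂
    linarith [hhyp (ξ₁ 0) (ξ₁ T) (ξ₂ T) (ξ₂ t)]
  have hg₄ : t - dist (ξ₁ 0) (ξ₂ 0) - 2 * δ ≤ gromovProduct (ξ₁ 0) (ξ₁ t) (ξ₂ t) := by
    have hmin : t - dist (ξ₁ 0) (ξ₂ 0) - δ ≤ min (gromovProduct (ξ₁ 0) (ξ₁ t) (ξ₁ T))
        (gromovProduct (ξ₁ 0) (ξ₁ T) (ξ₂ t)) := le_min (by linarith) hg₃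
    linarith [hhyp (ξ₁ 0) (ξ₁ t) (ξ₁ T) (ξ₂ t)]
  rw [gromovProduct, d₁ t ht] at hg₄
  linarith [d₂ t ht]
end

section
/- Let (X,d) be a metric space, f : X → ℝ an L-Lipschitz function, and 0 < α ≤ L. Let x ∈ X and suppose there is a ray ξ : [0,∞) → X with ξ(0) = x and f(ξ(t)) ≤ f(x) − αt for all t ≥ 0. Then for any τ > 0 and any x_τ ∈ J^f_τ(x), one has d(x, x_τ) ≥ (L − √(L² − α²))·τ ≥ α²τ/(2L). -/
open Set Filter

/-- If `f` is `L`-Lipschitz, `0 < α ≤ L`, and there is a ray `ξ` from `x` along which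
`f(ξ(t)) ≤ f(x) − αt`, then any proximal point `x_τ` of `x` with step size `τ` satisfies
`d(x, x_τ) ≥ (L − √(L² − α²))τ ≥ α²τ/(2L)`. -/
theorem proximal_point_dist_ge {X : Type*} [MetricSpace X]
    (L : ℝ) (hL : 0 < L) (f : X → ℝ)
    (hf : ∀ x y : X, |f x - f y| ≤ L * dist x y)
    (α : ℝ) (hα : 0 < α) (hαL : α ≤ L)
    (x : X) (ξ : ℝ → X)
    (hξ : ∀ s ∈ Ici (0:ℝ), ∀ t ∈ Ici (0:ℝ), dist (ξ s) (ξ t) = |s - t|)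
    (hξ0 : ξ 0 = x)
    (hdecay : ∀ t ≥ (0:ℝ), f (ξ t) ≤ f x - α * t)
    (τ : ℝ) (hτ : 0 < τ) (xτ : X)
    (hprox : ∀ z : X, f xτ + dist x xτ ^ 2 / (2 * τ) ≤ f z + dist x z ^ 2 / (2 * τ)) :
    (L - Real.sqrt (L ^ 2 - α ^ 2)) * τ ≤ dist x xτ ∧
      α ^ 2 * τ / (2 * L) ≤ (L - Real.sqrt (L ^ 2 - α ^ 2)) * τ := by
  have hατ : 0 ≤ α * τ := by positivity
  have hdist : dist x (ξ (α * τ)) = α * τ := by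
    rw [← hξ0, hξ 0 self_mem_Ici _ hατ, zero_sub, abs_neg, abs_of_nonneg hατ]
  have hle : f xτ + dist x xτ ^ 2 / (2 * τ) ≤ f x - α ^ 2 * τ / 2 := by
    refine (hprox (ξ (α * τ))).trans ?_
    rw [hdist]
    have hsq : (α * τ) ^ 2 / (2 * τ) = α ^ 2 * τ / 2 := by field_simp
    rw [hsq]
    linarith [hdecay _ hατ]
  have hlip : f x - f xτ ≤ L * dist x xτ := (le_abs_self _).trans (hf x xτ)
  have hquad : dist x xτ ^ 2 ≤ (L * dist x xτ - α ^ 2 * τ / 2) * (2 * τ) := by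
    rw [← div_le_iff₀ (by positivity)]
    linarith
  have hnonneg : 0 ≤ L ^ 2 - α ^ 2 := by nlinarith
  constructor
  · have habs : |L * τ - dist x xτ| ≤ Real.sqrt (L ^ 2 - α ^ 2) * τ := by
      apply abs_le_of_sq_le_sq _ (by positivity)
      rw [mul_pow, Real.sq_sqrt hnonneg]
      nlinarith
    linarith [le_abs_self (L * τ - dist x xτ)]
  · have hbound : α ^ 2 / (2 * L) ≤ L / 2 := by
      rw [div_le_iff₀ (by positivity)]
      nlinarith
    have hmul : α ^ 2 / (2 * L) * (2 * L) = α ^ 2 := by field_simp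
    have hsqrt : Real.sqrt (L ^ 2 - α ^ 2) ≤ L - α ^ 2 / (2 * L) := by
      refine Real.sqrt_le_iff.mpr ⟨by linarith, ?_⟩
      nlinarith [sq_nonneg (α ^ 2 / (2 * L))]
    rw [mul_div_right_comm]
    exact mul_le_mul_of_nonneg_right (by linarith) hτ.le
end

section
/- Let (X,d) be a metric space, f : X → ℝ an L-Lipschitz function, and 0 < α ≤ L. Let x ∈ X and suppose there is a ray ξ : [0,∞) → X with ξ(0) = x and f(ξ(t)) ≤ f(x) − αt for all t ≥ 0. Then for any τ > 0 and any x_τ ∈ J^f_τ(x), one has f(x_τ) ≤ f(x) − α⁴τ/(8L²). -/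
open Set Filter

/-- If `f` is `L`-Lipschitz, `0 < α ≤ L`, and there is a ray `ξ` from `x` along which
`f(ξ(t)) ≤ f(x) − αt`, then any proximal point `x_τ` of `x` with step size `τ` satisfies
`f(x_τ) ≤ f(x) − α⁴τ/(8L²)`. -/
theorem proximal_point_value_decrease {X : Type*} [MetricSpace X]
    (L : ℝ) (hL : 0 < L) (f : X → ℝ)
    (hf : ∀ x y : X, |f x - f y| ≤ L * dist x y)
    (α : ℝ) (hα : 0 < α) (hαL : α ≤ L)
    (x : X) (ξ : ℝ → X)
    (hξ : ∀ s ∈ Ici (0:ℝ), ∀ t ∈ Ici (0:ℝ), dist (ξ s) (ξ t) = |s - t|)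
    (hξ0 : ξ 0 = x)
    (hdecay : ∀ t ≥ (0:ℝ), f (ξ t) ≤ f x - α * t)
    (τ : ℝ) (hτ : 0 < τ) (xτ : X)
    (hprox : ∀ z : X, f xτ + dist x xτ ^ 2 / (2 * τ) ≤ f z + dist x z ^ 2 / (2 * τ)) :
    f xτ ≤ f x - α ^ 4 * τ / (8 * L ^ 2) := by
  have hατ : 0 ≤ α * τ := by positivity
  have hdist : dist x (ξ (α * τ)) = α * τ := by
    have h := hξ 0 self_mem_Ici (α * τ) hατ
    rwa [hξ0, zero_sub, abs_neg, abs_of_nonneg hατ] at h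
  have hcompare := hprox (ξ (α * τ))
  rw [hdist] at hcompare
  have hdecay_step := hdecay (α * τ) hατ
  have hnonneg : 0 ≤ dist x xτ ^ 2 / (2 * τ) := by positivity
  have hpenalty : (α * τ) ^ 2 / (2 * τ) = α ^ 2 * τ / 2 := by
    field_simp
  have hbound : α ^ 4 * τ / (8 * L ^ 2) ≤ α ^ 2 * τ / 2 := by
    rw [div_le_div_iff₀ (by positivity) (by positivity)]
    have hsq : α ^ 2 ≤ L ^ 2 := by gcongr
    have hmul : α ^ 2 * τ * α ^ 2 ≤ α ^ 2 * τ * L ^ 2 := by gcongr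
    have hpos : 0 ≤ α ^ 2 * τ * L ^ 2 := by positivity
    linarith
  linarith
end

section
/- Let (X,d) be a proper, geodesic δ-hyperbolic metric space and f : X → ℝ an L-Lipschitz convex function. Then for any τ > 0, any x ∈ X, any y ∈ J^f_τ(x), and any p ∈ X with f(p) ≤ f(y), one has d(p,y) ≤ d(p,x) − d(x,y) + 4√(2τLδ). -/
open Set Filter

/-- Contraction estimate: in a proper, geodesic `δ`-hyperbolic space, for an `L`-Lipschitz
convex function `f`, any `x`, any proximal point `y ∈ J^f_τ(x)`, and any `p` with
`f(p) ≤ f(y)`, one has `d(p,y) ≤ d(p,x) − d(x,y) + 4√(2τLδ)`. -/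
theorem proximal_contraction
    {X : Type*} [MetricSpace X] [ProperSpace X] (δ : ℝ) (hδ : 0 ≤ δ)
    (hgeo : ∀ x y : X, ∃ γ : ℝ → X, γ 0 = x ∧ γ 1 = y ∧
      ∀ s ∈ Icc (0:ℝ) 1, ∀ t ∈ Icc (0:ℝ) 1, dist (γ s) (γ t) = |s - t| * dist x y)
    (hhyp : ∀ p x y z : X,
      gromovProduct p x z ≥ min (gromovProduct p x y) (gromovProduct p y z) - δ)
    (L : ℝ) (hL : 0 < L) (f : X → ℝ)
    (hf : ∀ x y : X, |f x - f y| ≤ L * dist x y)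
    (hconv : ∀ x y : X, ∃ γ : ℝ → X, γ 0 = x ∧ γ 1 = y ∧
      (∀ s ∈ Icc (0:ℝ) 1, ∀ t ∈ Icc (0:ℝ) 1, dist (γ s) (γ t) = |s - t| * dist x y) ∧
      ∀ s ∈ Icc (0:ℝ) 1, f (γ s) ≤ (1 - s) * f x + s * f y)
    (τ : ℝ) (hτ : 0 < τ) (x y p : X)
    (hprox : ∀ z : X, f y + dist x y ^ 2 / (2 * τ) ≤ f z + dist x z ^ 2 / (2 * τ))
    (hp : f p ≤ f y) :
    dist p y ≤ dist p x - dist x y + 4 * Real.sqrt (2 * τ * L * δ) := by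
  set g := gromovProduct y x p with hg
  have hg_def : g = (dist x y + dist p y - dist p x) / 2 := by
    rw [hg, gromovProduct, dist_comm y x, dist_comm y p, dist_comm x p]
  have hg_nonneg : 0 ≤ g := by
    linarith [dist_triangle p y x, dist_comm x y]
  have hg_le_left : g ≤ dist x y := by
    linarith [dist_triangle p x y]
  have hg_le_right : g ≤ dist p y := by
    linarith [dist_triangle x p y, dist_comm x p]
  have hg_le : g ≤ 2 * δ := by
    rcases (dist_nonneg (x := p) (y := y)).eq_or_lt with hb | hb
    · linarith
    obtain ⟨γ, h0, h1, hγ, hfγ⟩ := hconv y p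
    have hs : g / dist p y ∈ Icc (0 : ℝ) 1 :=
      ⟨div_nonneg hg_nonneg hb.le, (div_le_one hb).2 hg_le_right⟩
    have hmul : g / dist p y * dist p y = g := div_mul_cancel₀ _ hb.ne'
    have hyz := hγ 0 (by simp) _ hs
    have hpz := hγ 1 (by simp) _ hs
    have hfz := hfγ _ hs
    rw [h0, dist_comm y p, zero_sub, abs_neg, abs_of_nonneg hs.1, hmul] at hyz
    rw [h1, dist_comm y p, abs_of_nonneg (sub_nonneg.2 hs.2), sub_mul, hmul, one_mul] at hpz
    have hfz_le : f (γ (g / dist p y)) ≤ f y := by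
      nlinarith [mul_le_mul_of_nonneg_left hp hs.1]
    have hnear : dist x y ≤ dist x (γ (g / dist p y)) := by
      refine (sq_le_sq₀ dist_nonneg dist_nonneg).1 ?_
      have := hprox (γ (g / dist p y))
      exact (div_le_div_iff_of_pos_right (by positivity : 0 < 2 * τ)).1 (by linarith)
    have hthin := hhyp y x p (γ (g / dist p y))
    have hpz_product : gromovProduct y p (γ (g / dist p y)) = g := by
      rw [gromovProduct, hyz, hpz, dist_comm y p]
      ring
    rw [hpz_product, ← hg, min_self, gromovProduct, hyz, dist_comm y x] at hthin
    linarith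
  have hstep : dist x y ≤ 2 * τ * L := by
    rcases (dist_nonneg (x := x) (y := y)).eq_or_lt with ha | ha
    · rw [← ha]
      positivity
    have hx := hprox x
    rw [dist_self] at hx
    have hdiv : dist x y ^ 2 / (2 * τ) ≤ L * dist x y := by
      have := (le_abs_self _).trans (hf x y)
      norm_num at hx
      linarith
    rw [div_le_iff₀ (by positivity)] at hdiv
    exact le_of_mul_le_mul_right (by linarith) ha
  have hsqrt : g / 2 ≤ Real.sqrt (2 * τ * L * δ) := by
    apply Real.le_sqrt_of_sq_le
    nlinarith [mul_le_mul (hg_le_left.trans hstep) hg_le hg_nonneg (by positivity)]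
  linarith
end

section
/- Let (X,d) be a proper, geodesic δ-hyperbolic metric space and f : X → ℝ an L-Lipschitz convex function. Assume α > 0, where −α is the infimum of lim_{t→∞} f(ξ(t))/t over all rays ξ in X with f∘ξ convex (so α ≤ L). Fix τ > 0, x₀ ∈ X, and a sequence with x_k ∈ J^f_τ(x_{k−1}) for each k ∈ ℕ. Then for every k ∈ ℕ: f(x_k) ≤ f(x₀) − k·α⁴τ/(8L²), d(x₀, x_k) ≤ 2kτL, and d(x₀, x_k) ≥ k·α⁴τ/(8L³). -/
open Set Filter

/-- If `f` has asymptotic slope less than `c` along some ray, then from any point `p` one can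
move by any distance `r` so that `f` changes by at most `c * r`. -/
theorem exists_dist_eq_and_le_add_mul {X : Type*} [MetricSpace X] (f : X → ℝ)
    (hconv : ∀ x y : X, ∃ γ : ℝ → X, γ 0 = x ∧ γ 1 = y ∧
      (∀ s ∈ Icc (0:ℝ) 1, ∀ t ∈ Icc (0:ℝ) 1, dist (γ s) (γ t) = |s - t| * dist x y) ∧
      ∀ s ∈ Icc (0:ℝ) 1, f (γ s) ≤ (1 - s) * f x + s * f y)
    {ξ : ℝ → X} (hξ : ∀ s ∈ Ici (0:ℝ), ∀ t ∈ Ici (0:ℝ), dist (ξ s) (ξ t) = |s - t|)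
    {a c : ℝ} (hlim : Tendsto (fun t => f (ξ t) / t) atTop (nhds a)) (hac : a < c)
    (p : X) {r : ℝ} (hr : 0 < r) :
    ∃ z, dist p z = r ∧ f z ≤ f p + c * r := by
  obtain ⟨b, hab, hbc⟩ := exists_between hac
  have hbig : ∀ᶠ t : ℝ in atTop, (|c| * dist p (ξ 0) - f p) / (c - b) ≤ t :=
    eventually_ge_atTop _
  obtain ⟨t, hslope, hbig, hpos, hfar⟩ := ((hlim.eventually (gt_mem_nhds hab)).and
    (hbig.and ((eventually_gt_atTop (0:ℝ)).and
      (eventually_ge_atTop (r + dist p (ξ 0)))))).exists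
  rw [div_lt_iff₀ hpos] at hslope
  rw [div_le_iff₀ (sub_pos.2 hbc)] at hbig
  have hray : dist (ξ 0) (ξ t) = t := by
    rw [hξ 0 self_mem_Ici t hpos.le, zero_sub, abs_neg, abs_of_pos hpos]
  have hupper := dist_triangle p (ξ 0) (ξ t)
  have hlower := dist_triangle_left (ξ 0) (ξ t) p
  have hdiff : |t - dist p (ξ t)| ≤ dist p (ξ 0) := by
    rw [abs_le]; constructor <;> linarith
  have hmul : c * (t - dist p (ξ t)) ≤ |c| * dist p (ξ 0) :=
    (le_abs_self _).trans (by rw [abs_mul]; gcongr)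
  have hfall : f (ξ t) - f p ≤ c * dist p (ξ t) := by linarith
  have hrD : r ≤ dist p (ξ t) := by linarith
  have hD : 0 < dist p (ξ t) := hr.trans_le hrD
  obtain ⟨γ, hγ0, -, hγ, hfγ⟩ := hconv p (ξ t)
  have hs : r / dist p (ξ t) ∈ Icc (0:ℝ) 1 := ⟨by positivity, (div_le_one hD).2 hrD⟩
  refine ⟨γ (r / dist p (ξ t)), ?_, ?_⟩
  · have h := hγ 0 (by simp) _ hs
    rw [hγ0, zero_sub, abs_neg, abs_of_nonneg hs.1, div_mul_cancel₀ _ hD.ne'] at h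
    exact h
  · have h := mul_le_mul_of_nonneg_left hfall hs.1
    have hcr : r / dist p (ξ t) * (c * dist p (ξ t)) = c * r := by field_simp
    linarith [hfγ _ hs]

/-- Basic estimates for the discrete-time gradient flow: if `−α < 0` is the infimum of the
asymptotic slopes of the `L`-Lipschitz convex function `f` over all rays along which `f` is
convex, and `(x_k)` is a proximal sequence with step size `τ`, then
`f(x_k) ≤ f(x₀) − kα⁴τ/(8L²)`, `d(x₀,x_k) ≤ 2kτL`, and `d(x₀,x_k) ≥ kα⁴τ/(8L³)`. -/
theorem proximal_sequence_estimates
    {X : Type*} [MetricSpace X] [ProperSpace X] (δ : ℝ) (hδ : 0 ≤ δ)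
    (hgeo : ∀ x y : X, ∃ γ : ℝ → X, γ 0 = x ∧ γ 1 = y ∧
      ∀ s ∈ Icc (0:ℝ) 1, ∀ t ∈ Icc (0:ℝ) 1, dist (γ s) (γ t) = |s - t| * dist x y)
    (hhyp : ∀ p x y z : X,
      gromovProduct p x z ≥ min (gromovProduct p x y) (gromovProduct p y z) - δ)
    (L : ℝ) (hL : 0 < L) (f : X → ℝ)
    (hf : ∀ x y : X, |f x - f y| ≤ L * dist x y)
    (hconv : ∀ x y : X, ∃ γ : ℝ → X, γ 0 = x ∧ γ 1 = y ∧
      (∀ s ∈ Icc (0:ℝ) 1, ∀ t ∈ Icc (0:ℝ) 1, dist (γ s) (γ t) = |s - t| * dist x y) ∧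
      ∀ s ∈ Icc (0:ℝ) 1, f (γ s) ≤ (1 - s) * f x + s * f y)
    (α : ℝ) (hα : 0 < α)
    (hglb : IsGLB {a : ℝ | ∃ ξ : ℝ → X,
      (∀ s ∈ Ici (0:ℝ), ∀ t ∈ Ici (0:ℝ), dist (ξ s) (ξ t) = |s - t|) ∧
      ConvexOn ℝ (Ici (0:ℝ)) (fun t => f (ξ t)) ∧
      Tendsto (fun t => f (ξ t) / t) atTop (nhds a)} (-α))
    (τ : ℝ) (hτ : 0 < τ) (x : ℕ → X)
    (hprox : ∀ k : ℕ, ∀ z : X,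
      f (x (k + 1)) + dist (x k) (x (k + 1)) ^ 2 / (2 * τ) ≤
        f z + dist (x k) z ^ 2 / (2 * τ)) :
    ∀ k : ℕ,
      f (x k) ≤ f (x 0) - k * (α ^ 4 * τ / (8 * L ^ 2)) ∧
      dist (x 0) (x k) ≤ 2 * k * τ * L ∧
      k * (α ^ 4 * τ / (8 * L ^ 3)) ≤ dist (x 0) (x k) := by
  have hdescent (c : ℝ) (hc : -α < c) (p : X) (r : ℝ) (hr : 0 < r) :
      ∃ z, dist p z = r ∧ f z ≤ f p + c * r := by
    obtain ⟨a, ⟨ξ, hξ, -, hlim⟩, -, hac⟩ := hglb.exists_between hc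
    exact exists_dist_eq_and_le_add_mul f hconv hξ hlim hac p hr
  have hαL : α ≤ L := by
    refine le_of_forall_pos_le_add fun ε hε => ?_
    obtain ⟨z, hz, hfz⟩ := hdescent (-α + ε) (by linarith) (x 0) 1 one_pos
    have h := (abs_le.1 (hf (x 0) z)).2
    rw [hz] at h
    linarith
  have hdrop (k : ℕ) : f (x (k + 1)) ≤ f (x k) - α ^ 2 * τ / 2 := by
    refine le_of_forall_pos_le_add fun ε hε => ?_
    have hατ : 0 < α * τ := mul_pos hα hτ
    obtain ⟨z, hz, hfz⟩ := hdescent (-α + ε / (α * τ))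
      (by linarith [div_pos hε hατ]) (x k) (α * τ) hατ
    have h := hprox k z
    have hsq : 0 ≤ dist (x k) (x (k + 1)) ^ 2 / (2 * τ) := by positivity
    rw [hz] at h
    have h₁ : (α * τ) ^ 2 / (2 * τ) = α ^ 2 * τ / 2 := by field_simp
    have h₂ : (-α + ε / (α * τ)) * (α * τ) = -(α ^ 2 * τ) + ε := by field_simp
    linarith
  have hstep (k : ℕ) : dist (x k) (x (k + 1)) ≤ 2 * τ * L := by
    have h := hprox k (x k)
    have hlip := (abs_le.1 (hf (x k) (x (k + 1)))).2
    rw [dist_self, zero_pow two_ne_zero, zero_div, add_zero] at h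
    have hsq : dist (x k) (x (k + 1)) ^ 2 / (2 * τ) ≤ L * dist (x k) (x (k + 1)) := by linarith
    rw [div_le_iff₀ (by positivity)] at hsq
    by_contra! hlt
    have hpos : 0 < dist (x k) (x (k + 1)) := lt_trans (by positivity) hlt
    nlinarith
  have hrate : α ^ 4 * τ / (8 * L ^ 2) ≤ α ^ 2 * τ / 2 := by
    rw [div_le_iff₀ (by positivity)]
    have h : α ^ 2 ≤ L ^ 2 := by gcongr
    have h₁ : α ^ 2 * τ * α ^ 2 ≤ α ^ 2 * τ * L ^ 2 := by gcongr
    have h₂ : 0 ≤ α ^ 2 * τ * L ^ 2 := by positivity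
    linarith
  have hvalue (k : ℕ) : f (x k) ≤ f (x 0) - k * (α ^ 4 * τ / (8 * L ^ 2)) := by
    induction k with
    | zero => simp
    | succ k ih =>
      push_cast
      linarith [hdrop k]
  intro k
  refine ⟨hvalue k, ?_, ?_⟩
  · induction k with
    | zero => simp
    | succ k ih =>
      push_cast
      linarith [hstep k, dist_triangle (x 0) (x k) (x (k + 1))]
  · have h : k * (α ^ 4 * τ / (8 * L ^ 2)) ≤ L * dist (x 0) (x k) := by
      linarith [hvalue k, (abs_le.1 (hf (x 0) (x k))).2]
    calc k * (α ^ 4 * τ / (8 * L ^ 3)) = k * (α ^ 4 * τ / (8 * L ^ 2)) / L := by field_simp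
      _ ≤ dist (x 0) (x k) := (div_le_iff₀' hL).2 h
end

section
/- Let (X,d) be a proper, geodesic δ-hyperbolic metric space and f : X → ℝ an L-Lipschitz convex function. Assume α > 0, where −α is the infimum of lim_{t→∞} f(ξ(t))/t over all rays ξ in X with f∘ξ convex. Then for every x₀ ∈ X there exists a ray ξ : [0,∞) → X with ξ(0) = x₀, f∘ξ convex, and lim_{t→∞} f(ξ(t))/t ≤ −α⁴/(16L³); in particular, its asymptotic slope is negative. -/
open Set Filter

/-- In a nonempty compact space, a family of continuous real functions has a Pareto-minimal
point. -/
theorem exists_minimal_of_continuous {Y ι : Type*} [TopologicalSpace Y] [CompactSpace Y]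
    [Nonempty Y] (φ : ι → Y → ℝ) (hφ : ∀ i, Continuous (φ i)) :
    ∃ m : Y, ∀ y, (∀ i, φ i y ≤ φ i m) → ∀ i, φ i m ≤ φ i y := by
  refine exists_maximal_of_chains_bounded (r := fun x y : Y => ∀ i, φ i y ≤ φ i x) ?_
    (fun hab hbc i => (hbc i).trans (hab i))
  intro c hc
  rcases c.eq_empty_or_nonempty with rfl | hne
  · exact ⟨Classical.arbitrary Y, by simp⟩
  have : Nonempty c := hne.to_subtype
  have hclosed : ∀ a : c, IsClosed {y : Y | ∀ i, φ i y ≤ φ i a} := fun a => by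
    simp only [ofPred_forall]
    exact isClosed_iInter fun i => isClosed_le (hφ i) continuous_const
  obtain ⟨z, hz⟩ := IsCompact.nonempty_iInter_of_directed_nonempty_isCompact_isClosed
    (fun a : c => {y : Y | ∀ i, φ i y ≤ φ i a})
    (fun a b => by
      rcases eq_or_ne a b with rfl | hab
      · exact ⟨a, subset_rfl, subset_rfl⟩
      rcases hc a.2 b.2 (fun h => hab (Subtype.ext h)) with h | h
      · exact ⟨b, fun y hy i => (hy i).trans (h i), subset_rfl⟩
      · exact ⟨a, subset_rfl, fun y hy i => (hy i).trans (h i)⟩)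
    (fun a => ⟨a, fun i => le_rfl⟩)
    (fun a => (hclosed a).isCompact) hclosed
  exact ⟨z, fun a ha => mem_iInter.1 hz ⟨a, ha⟩⟩

/-- A continuous function on `[0,∞)` that is not convex lies strictly above an affine function on
the interior of some interval and weakly below it at the endpoints. -/
theorem exists_affine_lt_of_not_convexOn {g : ℝ → ℝ} (hg : ContinuousOn g (Ici 0))
    (hnc : ¬ ConvexOn ℝ (Ici 0) g) :
    ∃ p q m k : ℝ, 0 ≤ p ∧ p < q ∧ g p ≤ m * p + k ∧ g q ≤ m * q + k ∧
      ∀ u ∈ Ioo p q, m * u + k < g u := by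
  have hex : ∃ x z y : ℝ, 0 ≤ x ∧ x < z ∧ z < y ∧
      g x + (g y - g x) / (y - x) * (z - x) < g z := by
    by_contra! hcon
    apply hnc
    refine LinearOrder.convexOn_of_lt (convex_Ici 0) ?_
    intro x hx y _ hxy a b ha hb hab
    have hx' : (0:ℝ) ≤ x := hx
    have h := hcon x (a * x + b * y) y hx' (by nlinarith) (by nlinarith)
    have hyx : y - x ≠ 0 := by linarith
    have e : a * x + b * y - x = b * (y - x) := by
      rw [eq_sub_of_add_eq hab]; ring
    rw [e] at h
    have e2 : (g y - g x) / (y - x) * (b * (y - x)) = b * (g y - g x) := by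
      field_simp
    rw [e2] at h
    simp only [smul_eq_mul]
    have e3 : g x + b * (g y - g x) = a * g x + b * g y := by
      rw [eq_sub_of_add_eq hab]; ring
    linarith
  obtain ⟨x, z, y, hx, hxz, hzy, hlt⟩ := hex
  set m := (g y - g x) / (y - x) with hm
  set k := g x - m * x with hk
  have hmy : m * (y - x) = g y - g x := by
    rw [hm]; field_simp [(by linarith : y - x ≠ 0)]
  have hcomp : ∀ a b : ℝ, 0 ≤ a → IsCompact (Icc a b ∩ {u | g u ≤ m * u + k}) := by
    intro a b ha
    have hsub : Icc a b ⊆ Ici (0:ℝ) := fun u hu => ha.trans hu.1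
    refine isCompact_Icc.of_isClosed_subset ?_ inter_subset_left
    have hc : ContinuousOn (fun u => g u - (m * u + k)) (Icc a b) :=
      (hg.mono hsub).sub (by fun_prop)
    convert hc.preimage_isClosed_of_isClosed isClosed_Icc (isClosed_Iic (a := (0:ℝ))) using 1
    ext u; simp
  obtain ⟨p, ⟨⟨hp1, hp2⟩, hp3⟩, hpmax⟩ := (hcomp x z hx).exists_isGreatest
    ⟨x, ⟨le_rfl, hxz.le⟩, by simp [hk]⟩
  obtain ⟨q, ⟨⟨hq1, hq2⟩, hq3⟩, hqmin⟩ := (hcomp z y (by linarith)).exists_isLeast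
    ⟨y, ⟨hzy.le, le_rfl⟩, by simp only [mem_ofPred_eq, hk]; linarith⟩
  have hzz : m * z + k < g z := by rw [hk]; linarith
  have hp3' : g p ≤ m * p + k := hp3
  have hq3' : g q ≤ m * q + k := hq3
  have hpz : p < z := lt_of_le_of_ne hp2 (by rintro rfl; linarith)
  refine ⟨p, q, m, k, by linarith, by linarith, hp3, hq3, fun u hu => ?_⟩
  by_contra! hcon
  rcases le_total u z with h | h
  · exact absurd (hpmax ⟨⟨by linarith [hu.1], h⟩, hcon⟩) (not_le.2 hu.1)
  · exact absurd (hqmin ⟨⟨h, by linarith [hu.2]⟩, hcon⟩) (not_le.2 hu.2)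

/-- A convex function on `[0,∞)` with difference quotients at `0` bounded above by `b` has an
asymptotic slope, which is at most `b`. -/
theorem exists_tendsto_div_of_convexOn {g : ℝ → ℝ} (hg : ConvexOn ℝ (Ici 0) g) {b : ℝ}
    (hb : ∀ t, 0 ≤ t → g t ≤ g 0 + t * b) :
    ∃ a ≤ b, Tendsto (fun t => g t / t) atTop (nhds a) := by
  set φ : ℝ → ℝ := fun t => (g (max t 1) - g 0) / max t 1 with hφ
  have hpos : ∀ t : ℝ, 0 < max t 1 := fun t => lt_max_of_lt_right one_pos
  have hmono : Monotone φ := by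
    intro s t hst
    rcases (max_le_max_right 1 hst).eq_or_lt with h | h
    · simp [hφ, h]
    · simpa [hφ] using hg.secant_mono (a := 0) (x := max s 1) (y := max t 1)
        (mem_Ici.2 le_rfl) (hpos s).le (hpos t).le (hpos s).ne' (hpos t).ne' h.le
  have hle : ∀ t, φ t ≤ b := fun t => by
    rw [hφ]
    simp only
    rw [div_le_iff₀ (hpos t)]
    linarith [hb _ (hpos t).le]
  refine ⟨⨆ t, φ t, ciSup_le hle, ?_⟩
  have h1 := tendsto_atTop_ciSup hmono ⟨b, by rintro _ ⟨t, rfl⟩; exact hle t⟩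
  have h2 : Tendsto (fun t : ℝ => g 0 / t) atTop (nhds 0) := tendsto_const_nhds.div_atTop tendsto_id
  have h3 := h1.add h2
  rw [add_zero] at h3
  refine h3.congr' ?_
  filter_upwards [eventually_ge_atTop 1] with t ht
  simp only [hφ, max_eq_left ht]
  rw [← add_div]; ring

/-- Replacing a segment of a geodesic ray by another geodesic segment with the same endpoints
gives a geodesic ray. -/
theorem dist_replace_segment {X : Type*} [MetricSpace X] {η γ : ℝ → X} {p q : ℝ}
    (hη : ∀ s ∈ Ici (0:ℝ), ∀ t ∈ Ici (0:ℝ), dist (η s) (η t) = |s - t|)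
    (hp : 0 ≤ p) (hpq : p < q) (hγp : γ p = η p) (hγq : γ q = η q)
    (hγ : ∀ s ∈ Icc p q, ∀ t ∈ Icc p q, dist (γ s) (γ t) = |s - t|) :
    ∀ s ∈ Ici (0:ℝ), ∀ t ∈ Ici (0:ℝ),
      dist ((Icc p q).piecewise γ η s) ((Icc p q).piecewise γ η t) = |s - t| := by
  have hmix : ∀ s ∈ Icc p q, ∀ t, 0 ≤ t → t ∉ Icc p q → dist (γ s) (η t) = |s - t| := by
    intro s hs t ht htn
    have hpI := left_mem_Icc.2 hpq.le
    have hqI := right_mem_Icc.2 hpq.le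
    have a1 := hγ s hs p hpI
    have a2 := hγ s hs q hqI
    have b1 := hη p hp t ht
    have b2 := hη q (hp.trans hpq.le) t ht
    rw [hγp] at a1
    rw [hγq] at a2
    have c1 := dist_triangle (γ s) (η p) (η t)
    have c2 := dist_triangle (γ s) (η q) (η t)
    have c3 := dist_triangle_left (η q) (η t) (γ s)
    have c4 := dist_triangle_left (η p) (η t) (γ s)
    obtain ⟨hs1, hs2⟩ := hs
    rw [abs_of_nonneg (by linarith)] at a1
    rw [abs_of_nonpos (by linarith)] at a2
    rcases lt_or_ge t p with h | h
    · rw [abs_of_nonneg (by linarith)] at b1 b2 ⊢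
      linarith
    · have h' : q < t := by
        by_contra! hc
        exact htn ⟨h, hc⟩
      rw [abs_of_nonpos (by linarith)] at b1 b2 ⊢
      linarith
  intro s hs t ht
  by_cases h1 : s ∈ Icc p q <;> by_cases h2 : t ∈ Icc p q
  · simpa [piecewise, h1.1, h1.2, h2.1, h2.2] using hγ s h1 t h2
  · rw [piecewise_eq_of_mem _ _ _ h1, piecewise_eq_of_notMem _ _ _ h2]
    exact hmix s h1 t ht h2
  · rw [piecewise_eq_of_notMem _ _ _ h1, piecewise_eq_of_mem _ _ _ h2, dist_comm, abs_sub_comm]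
    exact hmix t h2 s hs h1
  · rw [piecewise_eq_of_notMem _ _ _ h1, piecewise_eq_of_notMem _ _ _ h2]
    exact hη s hs t ht

/-- The maps `η : ℝ → X` with `d(x₀, η s) ≤ |s|` for all `s` that are isometric on `N` and satisfy
`f (η s) ≤ f x₀ + s b` for `s ∈ N`. -/
def decreasingRays {X : Type*} [MetricSpace X] (f : X → ℝ) (x₀ : X) (b : ℝ) (N : Set ℝ) :
    Set (ℝ → X) :=
  {η | (∀ s, η s ∈ Metric.closedBall x₀ |s|) ∧
    (∀ s ∈ N, ∀ t ∈ N, dist (η s) (η t) = |s - t|) ∧ ∀ s ∈ N, f (η s) ≤ f x₀ + s * b}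

theorem isCompact_decreasingRays {X : Type*} [MetricSpace X] [ProperSpace X] {f : X → ℝ}
    (hf : Continuous f) (x₀ : X) (b : ℝ) (N : Set ℝ) :
    IsCompact (decreasingRays f x₀ b N) := by
  refine (isCompact_univ_pi fun s : ℝ => isCompact_closedBall x₀ |s|).of_isClosed_subset ?_
    fun η hη s _ => hη.1 s
  simp only [decreasingRays, ofPred_and, ofPred_forall]
  refine (isClosed_iInter fun s => ?_).inter
    ((isClosed_biInter fun s _ => isClosed_biInter fun t _ => ?_).inter
      (isClosed_biInter fun s _ => ?_))
  · exact Metric.isClosed_closedBall.preimage (continuous_apply s)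
  · exact isClosed_eq ((continuous_apply s).dist (continuous_apply t)) continuous_const
  · exact isClosed_le (hf.comp (continuous_apply s)) continuous_const

/-- In a proper space, a function admitting arbitrarily long geodesics from `x₀` satisfying the
linear bound `f ≤ f x₀ + b s` at the endpoint and the chord inequality admits a ray with this
bound. -/
theorem decreasingRays_Ici_nonempty {X : Type*} [MetricSpace X] [ProperSpace X] {f : X → ℝ}
    (hf : Continuous f)
    (hconv : ∀ x y : X, ∃ γ : ℝ → X, γ 0 = x ∧ γ 1 = y ∧
      (∀ s ∈ Icc (0:ℝ) 1, ∀ t ∈ Icc (0:ℝ) 1, dist (γ s) (γ t) = |s - t| * dist x y) ∧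
      ∀ s ∈ Icc (0:ℝ) 1, f (γ s) ≤ (1 - s) * f x + s * f y)
    (x₀ : X) (b : ℝ) (hfar : ∀ R : ℝ, ∃ y, R ≤ dist x₀ y ∧ f y ≤ f x₀ + dist x₀ y * b) :
    (decreasingRays f x₀ b (Ici 0)).Nonempty := by
  have hne : ∀ n : ℕ, (decreasingRays f x₀ b (Icc 0 n)).Nonempty := by
    intro n
    obtain ⟨y, hy, hfy⟩ := hfar (n + 1)
    obtain ⟨γ, h0, h1, hd, hc⟩ := hconv x₀ y
    set d := dist x₀ y with hd_def
    have hdpos : 0 < d := by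
      have : (0:ℝ) ≤ n := n.cast_nonneg
      linarith
    have hI : ∀ s ∈ Icc (0:ℝ) n, s / d ∈ Icc (0:ℝ) 1 := fun s hs =>
      ⟨div_nonneg hs.1 hdpos.le, (div_le_one hdpos).2 (by linarith [hs.2])⟩
    refine ⟨(Icc (0:ℝ) n).piecewise (fun s => γ (s / d)) (fun _ => x₀), fun s => ?_,
      fun s hs t ht => ?_, fun s hs => ?_⟩
    · by_cases hs : s ∈ Icc (0:ℝ) n
      · rw [piecewise_eq_of_mem _ _ _ hs, Metric.mem_closedBall]
        conv_lhs => rw [← h0]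
        rw [hd _ (hI s hs) 0 (by simp), sub_zero, abs_div, abs_of_pos hdpos,
          div_mul_cancel₀ _ hdpos.ne']
      · rw [piecewise_eq_of_notMem _ _ _ hs]
        exact Metric.mem_closedBall_self (abs_nonneg s)
    · rw [piecewise_eq_of_mem _ _ _ hs, piecewise_eq_of_mem _ _ _ ht,
        hd _ (hI s hs) _ (hI t ht), ← sub_div, abs_div, abs_of_pos hdpos,
        div_mul_cancel₀ _ hdpos.ne']
    · rw [piecewise_eq_of_mem _ _ _ hs]
      have h2 := hc _ (hI s hs)
      have h3 := mul_le_mul_of_nonneg_left hfy (hI s hs).1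
      have h4 : s / d * (f x₀ + d * b) = s / d * f x₀ + s * b := by
        field_simp
      linarith
  obtain ⟨η, hη⟩ := IsCompact.nonempty_iInter_of_sequence_nonempty_isCompact_isClosed
    (fun n : ℕ => decreasingRays f x₀ b (Icc 0 n))
    (fun n η hη => by
      have hsub : Icc (0:ℝ) n ⊆ Icc (0:ℝ) (n + 1 : ℕ) :=
        Icc_subset_Icc_right (by push_cast; linarith)
      exact ⟨hη.1, fun s hs t ht => hη.2.1 s (hsub hs) t (hsub ht),
        fun s hs => hη.2.2 s (hsub hs)⟩)
    hne (isCompact_decreasingRays hf x₀ b _)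
    (fun n => (isCompact_decreasingRays hf x₀ b _).isClosed)
  rw [mem_iInter] at hη
  refine ⟨η, (hη 0).1, fun s hs t ht => ?_, fun s hs => ?_⟩
  · obtain ⟨n, hn⟩ := exists_nat_ge (max s t)
    exact (hη n).2.1 s ⟨hs, (le_max_left _ _).trans hn⟩ t ⟨ht, (le_max_right _ _).trans hn⟩
  · obtain ⟨n, hn⟩ := exists_nat_ge s
    exact (hη n).2.2 s ⟨hs, hn⟩

/-- If there are rays from `x₀` with the linear bound `f ≤ f x₀ + b s`, then there is one along
which `f` is convex. -/
theorem exists_convexOn_decreasingRays {X : Type*} [MetricSpace X] [ProperSpace X] {f : X → ℝ}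
    (hf : Continuous f)
    (hconv : ∀ x y : X, ∃ γ : ℝ → X, γ 0 = x ∧ γ 1 = y ∧
      (∀ s ∈ Icc (0:ℝ) 1, ∀ t ∈ Icc (0:ℝ) 1, dist (γ s) (γ t) = |s - t| * dist x y) ∧
      ∀ s ∈ Icc (0:ℝ) 1, f (γ s) ≤ (1 - s) * f x + s * f y)
    {x₀ : X} {b : ℝ} (hne : (decreasingRays f x₀ b (Ici 0)).Nonempty) :
    ∃ η ∈ decreasingRays f x₀ b (Ici 0), ConvexOn ℝ (Ici (0:ℝ)) (fun t => f (η t)) := by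
  have : CompactSpace (decreasingRays f x₀ b (Ici 0)) :=
    isCompact_iff_compactSpace.1 (isCompact_decreasingRays hf x₀ b _)
  have : Nonempty (decreasingRays f x₀ b (Ici 0)) := hne.to_subtype
  obtain ⟨⟨η, hη⟩, hmin⟩ := exists_minimal_of_continuous
    (fun (s : Ici (0:ℝ)) (η : decreasingRays f x₀ b (Ici 0)) => f (η.1 s))
    (fun s => hf.comp ((continuous_apply (s : ℝ)).comp continuous_subtype_val))
  refine ⟨η, hη, ?_⟩
  by_contra hnc
  obtain ⟨hball, hgeod, hbound⟩ := hη
  have hηcont : ContinuousOn η (Ici 0) :=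
    (LipschitzOnWith.of_dist_le_mul (K := 1) fun s hs t ht => by
      rw [hgeod s hs t ht, Real.dist_eq]; simp).continuousOn
  obtain ⟨p, q, m, k, hp, hpq, hgp, hgq, hlt⟩ :=
    exists_affine_lt_of_not_convexOn (hf.comp_continuousOn hηcont) hnc
  simp only [Function.comp_apply] at hgp hgq hlt
  have hq : 0 ≤ q := hp.trans hpq.le
  have hqp : 0 < q - p := sub_pos.2 hpq
  obtain ⟨γ, h0, h1, hd, hc⟩ := hconv (η p) (η q)
  have hdist : dist (η p) (η q) = q - p := by
    rw [hgeod p hp q hq, abs_sub_comm, abs_of_pos hqp]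
  have hI : ∀ s ∈ Icc p q, (s - p) / (q - p) ∈ Icc (0:ℝ) 1 := fun s hs =>
    ⟨div_nonneg (by linarith [hs.1]) hqp.le, (div_le_one hqp).2 (by linarith [hs.2])⟩
  set γ' : ℝ → X := fun s => γ ((s - p) / (q - p)) with hγ'
  have hγp : γ' p = η p := by simp [hγ', h0]
  have hγq : γ' q = η q := by simp [hγ', hqp.ne', h1]
  have hγd : ∀ s ∈ Icc p q, ∀ t ∈ Icc p q, dist (γ' s) (γ' t) = |s - t| := by
    intro s hs t ht
    rw [hd _ (hI s hs) _ (hI t ht), hdist, ← sub_div, abs_div, abs_of_pos hqp,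
      div_mul_cancel₀ _ hqp.ne', sub_sub_sub_cancel_right]
  have hγline : ∀ s ∈ Icc p q, f (γ' s) ≤ m * s + k := by
    intro s hs
    obtain ⟨hI0, hI1⟩ := hI s hs
    have h2 := hc _ (hI s hs)
    have h3 := mul_le_mul_of_nonneg_left hgp (sub_nonneg.2 hI1)
    have h4 := mul_le_mul_of_nonneg_left hgq hI0
    have h5 : (1 - (s - p) / (q - p)) * (m * p + k) + (s - p) / (q - p) * (m * q + k)
        = m * s + k := by
      field_simp
      ring
    simp only [hγ']
    linarith
  have hγle : ∀ s ∈ Icc p q, f (γ' s) ≤ f (η s) := by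
    intro s hs
    rcases hs.1.eq_or_lt with rfl | h
    · rw [hγp]
    rcases hs.2.eq_or_lt with rfl | h'
    · rw [hγq]
    exact (hγline s hs).trans (hlt s ⟨h, h'⟩).le
  set ζ := (Icc p q).piecewise γ' η with hζ
  have hζle : ∀ s, f (ζ s) ≤ f (η s) := by
    intro s
    by_cases hs : s ∈ Icc p q
    · rw [hζ, piecewise_eq_of_mem _ _ _ hs]
      exact hγle s hs
    · rw [hζ, piecewise_eq_of_notMem _ _ _ hs]
  have hζd := dist_replace_segment hgeod hp hpq hγp hγq hγd
  have hη0 : η 0 = x₀ := by simpa using hball 0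
  have hζ0 : ζ 0 = x₀ := by
    by_cases h : (0:ℝ) ∈ Icc p q
    · have : p = 0 := le_antisymm h.1 hp
      rw [hζ, piecewise_eq_of_mem _ _ _ h, ← hη0, ← this, hγp]
    · rw [hζ, piecewise_eq_of_notMem _ _ _ h, hη0]
  have hζmem : ζ ∈ decreasingRays f x₀ b (Ici 0) := by
    refine ⟨fun s => ?_, hζd, fun s hs => (hζle s).trans (hbound s hs)⟩
    rcases le_or_gt 0 s with hs | hs
    · rw [Metric.mem_closedBall, ← hζ0]
      simpa only [sub_zero] using (hζd s hs 0 (mem_Ici.2 le_rfl)).le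
    · rw [hζ, piecewise_eq_of_notMem _ _ _ fun h => by linarith [h.1]]
      exact hball s
  have hmid : (p + q) / 2 ∈ Ioo p q := ⟨by linarith, by linarith⟩
  have hfin := hmin ⟨ζ, hζmem⟩ (fun s => hζle s) ⟨(p + q) / 2, mem_Ici.2 (by linarith)⟩
  simp only [hζ, piecewise_eq_of_mem _ _ _ (Ioo_subset_Icc_self hmid)] at hfin
  linarith [hγline _ (Ioo_subset_Icc_self hmid), hlt _ hmid]

/-- If `−α < 0` is the infimum of the asymptotic slopes of the `L`-Lipschitz convex
function `f` over all rays along which `f` is convex, then from every point `x₀` there is a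
ray `ξ` with `ξ(0) = x₀`, `f ∘ ξ` convex, and asymptotic slope at most `−α⁴/(16L³) < 0`. -/
theorem exists_ray_of_negative_slope
    {X : Type*} [MetricSpace X] [ProperSpace X] (δ : ℝ) (hδ : 0 ≤ δ)
    (hgeo : ∀ x y : X, ∃ γ : ℝ → X, γ 0 = x ∧ γ 1 = y ∧
      ∀ s ∈ Icc (0:ℝ) 1, ∀ t ∈ Icc (0:ℝ) 1, dist (γ s) (γ t) = |s - t| * dist x y)
    (hhyp : ∀ p x y z : X,
      gromovProduct p x z ≥ min (gromovProduct p x y) (gromovProduct p y z) - δ)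
    (L : ℝ) (hL : 0 < L) (f : X → ℝ)
    (hf : ∀ x y : X, |f x - f y| ≤ L * dist x y)
    (hconv : ∀ x y : X, ∃ γ : ℝ → X, γ 0 = x ∧ γ 1 = y ∧
      (∀ s ∈ Icc (0:ℝ) 1, ∀ t ∈ Icc (0:ℝ) 1, dist (γ s) (γ t) = |s - t| * dist x y) ∧
      ∀ s ∈ Icc (0:ℝ) 1, f (γ s) ≤ (1 - s) * f x + s * f y)
    (α : ℝ) (hα : 0 < α)
    (hglb : IsGLB {a : ℝ | ∃ ξ : ℝ → X,
      (∀ s ∈ Ici (0:ℝ), ∀ t ∈ Ici (0:ℝ), dist (ξ s) (ξ t) = |s - t|) ∧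
      ConvexOn ℝ (Ici (0:ℝ)) (fun t => f (ξ t)) ∧
      Tendsto (fun t => f (ξ t) / t) atTop (nhds a)} (-α))
    (x₀ : X) :
    ∃ (ξ : ℝ → X) (a : ℝ),
      (∀ s ∈ Ici (0:ℝ), ∀ t ∈ Ici (0:ℝ), dist (ξ s) (ξ t) = |s - t|) ∧
      ξ 0 = x₀ ∧
      ConvexOn ℝ (Ici (0:ℝ)) (fun t => f (ξ t)) ∧
      Tendsto (fun t => f (ξ t) / t) atTop (nhds a) ∧
      a ≤ -(α ^ 4 / (16 * L ^ 3)) := by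
  have hcont : Continuous f :=
    (LipschitzWith.of_dist_le_mul (K := ⟨L, hL.le⟩) fun x y => hf x y).continuous
  have hαL : α ≤ L := by
    suffices h : -L ∈ lowerBounds {a : ℝ | ∃ ξ : ℝ → X,
        (∀ s ∈ Ici (0:ℝ), ∀ t ∈ Ici (0:ℝ), dist (ξ s) (ξ t) = |s - t|) ∧
        ConvexOn ℝ (Ici (0:ℝ)) (fun t => f (ξ t)) ∧
        Tendsto (fun t => f (ξ t) / t) atTop (nhds a)} by
      linarith [hglb.2 h]
    rintro a ⟨ξ, hξ, -, ha⟩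
    have h2 : Tendsto (fun t : ℝ => f (ξ 0) / t - L) atTop (nhds (0 - L)) :=
      (tendsto_const_nhds.div_atTop tendsto_id).sub_const L
    rw [zero_sub] at h2
    refine le_of_tendsto_of_tendsto h2 ha ?_
    filter_upwards [eventually_gt_atTop 0] with t ht
    have h3 := (abs_le.1 (hf (ξ t) (ξ 0))).1
    rw [hξ t ht.le 0 (mem_Ici.2 le_rfl), sub_zero, abs_of_pos ht] at h3
    rw [sub_le_iff_le_add, ← sub_le_iff_le_add', ← sub_div, div_le_iff₀ ht]
    linarith
  have hslope : α ^ 4 / (16 * L ^ 3) < α := by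
    rw [div_lt_iff₀ (by positivity)]
    have : α ^ 3 ≤ L ^ 3 := pow_le_pow_left₀ hα.le hαL 3
    have h1 : α * α ^ 3 ≤ α * L ^ 3 := mul_le_mul_of_nonneg_left this hα.le
    have h2 : 0 < α * L ^ 3 := by positivity
    nlinarith
  set b := -(α ^ 4 / (16 * L ^ 3)) with hb
  have hbneg : b < 0 := by
    rw [hb]
    have : 0 < α ^ 4 / (16 * L ^ 3) := by positivity
    linarith
  obtain ⟨a, ⟨ξ, hξ, -, ha⟩, -, hab⟩ := hglb.exists_between (show -α < b by linarith)
  obtain ⟨c, hac, hcb⟩ := exists_between hab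
  have hfar : ∀ R : ℝ, ∃ y, R ≤ dist x₀ y ∧ f y ≤ f x₀ + dist x₀ y * b := by
    intro R
    set D := dist x₀ (ξ 0)
    obtain ⟨t, ht, htR, hlarge, hfc⟩ := ((eventually_gt_atTop 0).and
      ((eventually_ge_atTop (R + D)).and ((eventually_ge_atTop ((-f x₀ - D * b) / (b - c))).and
        (ha.eventually (gt_mem_nhds hac))))).exists
    have hd : dist (ξ 0) (ξ t) = t := by
      rw [hξ 0 (mem_Ici.2 le_rfl) t ht.le, zero_sub, abs_neg, abs_of_pos ht]
    rw [div_lt_iff₀ ht] at hfc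
    rw [div_le_iff₀ (by linarith)] at hlarge
    have h1 := dist_triangle x₀ (ξ 0) (ξ t)
    have h2 := dist_triangle_left (ξ 0) (ξ t) x₀
    refine ⟨ξ t, by linarith, ?_⟩
    have h3 := mul_le_mul_of_nonpos_right (h1.trans_eq (by rw [hd])) hbneg.le
    linarith
  obtain ⟨η, ⟨hball, hgeod, hbound⟩, hconvη⟩ := exists_convexOn_decreasingRays hcont hconv
    (decreasingRays_Ici_nonempty hcont hconv x₀ b hfar)
  have hη0 : η 0 = x₀ := by simpa using hball 0
  obtain ⟨a', ha'b, ha'⟩ := exists_tendsto_div_of_convexOn hconvη (b := b)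
    (fun t ht => by rw [hη0]; exact hbound t ht)
  exact ⟨η, a', hgeod, hη0, hconvη, ha', ha'b⟩
end

section
/- Let (X,d) be a proper, geodesic δ-hyperbolic metric space and f : X → ℝ an L-Lipschitz convex function. Assume α > 0, where −α is the infimum of lim_{t→∞} f(ξ(t))/t over all rays ξ in X with f∘ξ convex. Fix τ > 0, x₀ ∈ X, and a sequence with x_k ∈ J^f_τ(x_{k−1}) for each k ∈ ℕ. Let ξ : [0,∞) → X be a ray with ξ(0) = x₀, f∘ξ convex, and lim_{t→∞} f(ξ(t))/t = −α (a ray from x₀ representing the unique direction of negative asymptotic slope). Then for all k ∈ ℕ and all t > 0 with f(ξ(t)) ≤ f(x_k), one has (ξ(t) | x_k)_{x₀} ≥ k·√τ·( (α²/(4L) + α⁴/(16L³))·√τ − 2√(2Lδ) ). -/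
open Set Filter

section

variable {X : Type*} [MetricSpace X]

theorem gromovProduct_nonneg (p x y : X) : 0 ≤ gromovProduct p x y := by
  have := dist_triangle x p y
  rw [dist_comm x p] at this
  unfold gromovProduct
  linarith

theorem gromovProduct_le_dist_left (p x y : X) : gromovProduct p x y ≤ dist p x := by
  have := dist_triangle p x y
  unfold gromovProduct
  linarith

theorem gromovProduct_le_dist_right (p x y : X) : gromovProduct p x y ≤ dist p y := by
  have := dist_triangle p y x
  rw [dist_comm y x] at this
  unfold gromovProduct
  linarith

/-- A geodesically convex function on a space satisfies the interpolation bound at a point at any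
prescribed distance `r ≤ dist x y` along some geodesic from `x` to `y`. -/
theorem exists_point_dist_eq_of_convex {f : X → ℝ}
    (hconv : ∀ x y : X, ∃ γ : ℝ → X, γ 0 = x ∧ γ 1 = y ∧
      (∀ s ∈ Icc (0:ℝ) 1, ∀ t ∈ Icc (0:ℝ) 1, dist (γ s) (γ t) = |s - t| * dist x y) ∧
      ∀ s ∈ Icc (0:ℝ) 1, f (γ s) ≤ (1 - s) * f x + s * f y)
    {x y : X} (hxy : 0 < dist x y) {r : ℝ} (hr : 0 ≤ r) (hr' : r ≤ dist x y) :
    ∃ z : X, dist x z = r ∧ dist z y = dist x y - r ∧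
      f z ≤ f x + r * ((f y - f x) / dist x y) := by
  obtain ⟨γ, h0, h1, hγ, hfγ⟩ := hconv x y
  have hs0 : 0 ≤ r / dist x y := by positivity
  have hs1 : r / dist x y ≤ 1 := (div_le_one hxy).2 hr'
  refine ⟨γ (r / dist x y), ?_, ?_, ?_⟩
  · have := hγ 0 (by simp) _ ⟨hs0, hs1⟩
    rw [h0, zero_sub, abs_neg, abs_of_nonneg hs0] at this
    rw [this]
    field_simp
  · have := hγ _ ⟨hs0, hs1⟩ 1 (by simp)
    rw [h1, abs_sub_comm, abs_of_nonneg (by linarith)] at this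
    rw [this]
    field_simp
  · refine (hfγ _ ⟨hs0, hs1⟩).trans (le_of_eq ?_)
    ring

/-- If `y` is a proximal point of `x` and `f p ≤ f y`, then `(x|p)_y ≤ 2δ`. -/
theorem gromovProduct_proximal_le {δ : ℝ} (hδ : 0 ≤ δ)
    (hhyp : ∀ p x y z : X,
      gromovProduct p x z ≥ min (gromovProduct p x y) (gromovProduct p y z) - δ)
    {f : X → ℝ}
    (hconv : ∀ x y : X, ∃ γ : ℝ → X, γ 0 = x ∧ γ 1 = y ∧
      (∀ s ∈ Icc (0:ℝ) 1, ∀ t ∈ Icc (0:ℝ) 1, dist (γ s) (γ t) = |s - t| * dist x y) ∧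
      ∀ s ∈ Icc (0:ℝ) 1, f (γ s) ≤ (1 - s) * f x + s * f y)
    {τ : ℝ} (hτ : 0 < τ) {x y p : X}
    (hprox : ∀ z : X, f y + dist x y ^ 2 / (2 * τ) ≤ f z + dist x z ^ 2 / (2 * τ))
    (hp : f p ≤ f y) : gromovProduct y x p ≤ 2 * δ := by
  have ha := gromovProduct_nonneg y x p
  have ha' := gromovProduct_le_dist_right y x p
  set a := gromovProduct y x p with hadef
  rcases (dist_nonneg (x := y) (y := p)).eq_or_lt with hd | hd
  · linarith
  obtain ⟨z, hyz, hzp, hfz⟩ := exists_point_dist_eq_of_convex hconv hd ha ha'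
  have hfz' : f z ≤ f y := by
    have : a * ((f p - f y) / dist y p) ≤ 0 :=
      mul_nonpos_of_nonneg_of_nonpos ha (div_nonpos_of_nonpos_of_nonneg (by linarith) hd.le)
    linarith
  have hxz : dist x y ≤ dist x z := by
    have hz := hprox z
    have h : dist x y ^ 2 / (2 * τ) ≤ dist x z ^ 2 / (2 * τ) := by linarith
    have h' := (div_le_div_iff_of_pos_right (by positivity : 0 < 2 * τ)).1 h
    exact (sq_le_sq₀ dist_nonneg dist_nonneg).1 h'
  have hpz : gromovProduct y p z = a := by
    rw [gromovProduct, hyz, dist_comm p z, hzp]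
    ring
  have h := hhyp y x p z
  rw [← hadef, hpz, min_self, gromovProduct, hyz, dist_comm y x] at h
  linarith

/-- The step length of a proximal point is at most `2τL` for an `L`-Lipschitz function. -/
theorem dist_proximal_le {L : ℝ} {f : X → ℝ} (hf : ∀ x y : X, |f x - f y| ≤ L * dist x y)
    {τ : ℝ} (hτ : 0 < τ) {x y : X}
    (hprox : ∀ z : X, f y + dist x y ^ 2 / (2 * τ) ≤ f z + dist x z ^ 2 / (2 * τ))
    (hL : 0 ≤ L) : dist x y ≤ 2 * τ * L := by
  have h := hprox x
  simp only [dist_self, ne_eq, OfNat.ofNat_ne_zero, not_false_eq_true, zero_pow, zero_div,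
    add_zero] at h
  have h' := (le_abs_self _).trans (hf x y)
  have h2 : dist x y ^ 2 / (2 * τ) ≤ L * dist x y := by linarith
  rw [div_le_iff₀ (by positivity)] at h2
  rcases (dist_nonneg (x := x) (y := y)).eq_or_lt with hd | hd
  · rw [← hd]
    positivity
  · nlinarith

/-- If `y` is a proximal point of `x` and `f p ≤ f y`, then `x`, `y`, `p` are almost aligned. -/
theorem dist_add_dist_proximal_le {δ : ℝ} (hδ : 0 ≤ δ)
    (hhyp : ∀ p x y z : X,
      gromovProduct p x z ≥ min (gromovProduct p x y) (gromovProduct p y z) - δ)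
    {L : ℝ} (hL : 0 ≤ L) {f : X → ℝ} (hf : ∀ x y : X, |f x - f y| ≤ L * dist x y)
    (hconv : ∀ x y : X, ∃ γ : ℝ → X, γ 0 = x ∧ γ 1 = y ∧
      (∀ s ∈ Icc (0:ℝ) 1, ∀ t ∈ Icc (0:ℝ) 1, dist (γ s) (γ t) = |s - t| * dist x y) ∧
      ∀ s ∈ Icc (0:ℝ) 1, f (γ s) ≤ (1 - s) * f x + s * f y)
    {τ : ℝ} (hτ : 0 < τ) {x y p : X}
    (hprox : ∀ z : X, f y + dist x y ^ 2 / (2 * τ) ≤ f z + dist x z ^ 2 / (2 * τ))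
    (hp : f p ≤ f y) :
    dist x y + dist y p ≤ dist x p + 4 * (√τ * √(2 * L * δ)) := by
  have h0 := gromovProduct_nonneg y x p
  have h1 := gromovProduct_proximal_le hδ hhyp hconv hτ hprox hp
  have h2 := gromovProduct_le_dist_left y x p
  rw [dist_comm y x] at h2
  have h3 := h2.trans (dist_proximal_le hf hτ hprox hL)
  have hsq : gromovProduct y x p ^ 2 ≤ (2 * (√τ * √(2 * L * δ))) ^ 2 := by
    rw [mul_pow, mul_pow, Real.sq_sqrt hτ.le, Real.sq_sqrt (by positivity)]
    have : 0 ≤ τ * (L * δ) := by positivity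
    have := mul_le_mul h3 h1 h0 (by positivity)
    nlinarith
  have h := (sq_le_sq₀ h0 (by positivity)).1 hsq
  rw [gromovProduct, dist_comm y x] at h
  linarith

/-- The difference quotients of `f` between a fixed point `x` and the points of a ray converge to
the asymptotic slope of `f` along the ray. -/
theorem tendsto_slope_to_ray {f : X → ℝ} {a : ℝ} {ξ : ℝ → X}
    (hξ : ∀ s ∈ Ici (0:ℝ), ∀ t ∈ Ici (0:ℝ), dist (ξ s) (ξ t) = |s - t|)
    (hslope : Tendsto (fun t => f (ξ t) / t) atTop (nhds a)) (x : X) :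
    Tendsto (fun t => (f (ξ t) - f x) / dist x (ξ t)) atTop (nhds a) := by
  have hdist : Tendsto (fun t => dist x (ξ t) / t) atTop (nhds 1) := by
    have hc : Tendsto (fun t : ℝ => dist x (ξ 0) / t) atTop (nhds 0) :=
      tendsto_const_nhds.div_atTop tendsto_id
    have hlow : Tendsto (fun t : ℝ => 1 - dist x (ξ 0) / t) atTop (nhds 1) := by
      simpa using hc.const_sub 1
    have hup : Tendsto (fun t : ℝ => 1 + dist x (ξ 0) / t) atTop (nhds 1) := by
      simpa using hc.const_add 1
    refine tendsto_of_tendsto_of_tendsto_of_le_of_le' hlow hup ?_ ?_ <;>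
      filter_upwards [eventually_gt_atTop 0] with t ht
    all_goals
      have h0 : dist (ξ 0) (ξ t) = t := by
        rw [hξ 0 self_mem_Ici t ht.le, zero_sub, abs_neg, abs_of_pos ht]
      have h1 := dist_triangle x (ξ 0) (ξ t)
      have h2 := dist_triangle (ξ 0) x (ξ t)
      rw [dist_comm (ξ 0) x] at h2
    · rw [le_div_iff₀ ht, sub_mul, div_mul_cancel₀ _ ht.ne']
      linarith
    · rw [div_le_iff₀ ht, add_mul, div_mul_cancel₀ _ ht.ne']
      linarith
  have hconst : Tendsto (fun t : ℝ => f x / t) atTop (nhds 0) :=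
    tendsto_const_nhds.div_atTop tendsto_id
  have h := (hslope.sub hconst).div hdist one_ne_zero
  rw [sub_zero, div_one] at h
  refine h.congr' ?_
  filter_upwards [eventually_gt_atTop 0] with t ht
  simp only [Pi.div_apply]
  rw [← sub_div, div_div_div_cancel_right₀ ht.ne']

theorem tendsto_dist_ray_atTop {ξ : ℝ → X}
    (hξ : ∀ s ∈ Ici (0:ℝ), ∀ t ∈ Ici (0:ℝ), dist (ξ s) (ξ t) = |s - t|) (x : X) :
    Tendsto (fun t => dist x (ξ t)) atTop atTop := by
  refine tendsto_atTop_mono' _ ?_ (tendsto_atTop_add_const_right _ (-dist x (ξ 0)) tendsto_id)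
  filter_upwards [eventually_gt_atTop 0] with t ht
  have h0 : dist (ξ 0) (ξ t) = t := by
    rw [hξ 0 self_mem_Ici t ht.le, zero_sub, abs_neg, abs_of_pos ht]
  have h2 := dist_triangle (ξ 0) x (ξ t)
  rw [dist_comm (ξ 0) x] at h2
  simp only [id_eq]
  linarith

/-- A proximal step decreases `f` by at least the amount given by the asymptotic slope. -/
theorem proximal_value_le {f : X → ℝ}
    (hconv : ∀ x y : X, ∃ γ : ℝ → X, γ 0 = x ∧ γ 1 = y ∧
      (∀ s ∈ Icc (0:ℝ) 1, ∀ t ∈ Icc (0:ℝ) 1, dist (γ s) (γ t) = |s - t| * dist x y) ∧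
      ∀ s ∈ Icc (0:ℝ) 1, f (γ s) ≤ (1 - s) * f x + s * f y)
    {τ : ℝ} {x y : X}
    (hprox : ∀ z : X, f y + dist x y ^ 2 / (2 * τ) ≤ f z + dist x z ^ 2 / (2 * τ))
    {a : ℝ} {ξ : ℝ → X}
    (hξ : ∀ s ∈ Ici (0:ℝ), ∀ t ∈ Ici (0:ℝ), dist (ξ s) (ξ t) = |s - t|)
    (hslope : Tendsto (fun t => f (ξ t) / t) atTop (nhds a)) {r : ℝ} (hr : 0 ≤ r) :
    f y + dist x y ^ 2 / (2 * τ) ≤ f x + r * a + r ^ 2 / (2 * τ) := by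
  have hlim : Tendsto (fun t => f x + r * ((f (ξ t) - f x) / dist x (ξ t)) + r ^ 2 / (2 * τ))
      atTop (nhds (f x + r * a + r ^ 2 / (2 * τ))) :=
    (((tendsto_slope_to_ray hξ hslope x).const_mul r).const_add (f x)).add_const _
  refine ge_of_tendsto hlim ?_
  have hd := tendsto_dist_ray_atTop hξ x
  filter_upwards [hd.eventually_gt_atTop 0, hd.eventually_ge_atTop r] with t ht htr
  obtain ⟨z, hxz, -, hfz⟩ := exists_point_dist_eq_of_convex hconv ht hr htr
  have := hprox z
  rw [hxz] at this
  linarith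

/-- A lower bound on the length of a proximal step. -/
theorem le_dist_proximal {L : ℝ} (hL : 0 < L) {f : X → ℝ}
    (hf : ∀ x y : X, |f x - f y| ≤ L * dist x y)
    (hconv : ∀ x y : X, ∃ γ : ℝ → X, γ 0 = x ∧ γ 1 = y ∧
      (∀ s ∈ Icc (0:ℝ) 1, ∀ t ∈ Icc (0:ℝ) 1, dist (γ s) (γ t) = |s - t| * dist x y) ∧
      ∀ s ∈ Icc (0:ℝ) 1, f (γ s) ≤ (1 - s) * f x + s * f y)
    {τ : ℝ} (hτ : 0 < τ) {x y : X}
    (hprox : ∀ z : X, f y + dist x y ^ 2 / (2 * τ) ≤ f z + dist x z ^ 2 / (2 * τ))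
    {α : ℝ} (hα : 0 ≤ α) {ξ : ℝ → X}
    (hξ : ∀ s ∈ Ici (0:ℝ), ∀ t ∈ Ici (0:ℝ), dist (ξ s) (ξ t) = |s - t|)
    (hslope : Tendsto (fun t => f (ξ t) / t) atTop (nhds (-α))) :
    2 * τ * (α ^ 2 / (4 * L) + α ^ 4 / (16 * L ^ 3)) ≤ dist x y := by
  have h := proximal_value_le hconv hprox hξ hslope (by positivity : 0 ≤ τ * α)
  have h' := (le_abs_self _).trans (hf x y)
  have e : (τ * α) ^ 2 / (2 * τ) = τ * α ^ 2 / 2 := by field_simp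
  rw [e] at h
  set d := dist x y
  have hd : 0 ≤ d := dist_nonneg
  have key : τ * α ^ 2 / 2 + d ^ 2 / (2 * τ) ≤ L * d := by nlinarith
  have hcoarse : τ * α ^ 2 / (2 * L) ≤ d := by
    have : 0 ≤ d ^ 2 / (2 * τ) := by positivity
    rw [div_le_iff₀ (by positivity)]
    linarith
  have hsq : (τ * α ^ 2 / (2 * L)) ^ 2 / (2 * τ) ≤ d ^ 2 / (2 * τ) := by gcongr
  have hfine : τ * α ^ 2 / 2 + (τ * α ^ 2 / (2 * L)) ^ 2 / (2 * τ) ≤ d * L := by linarith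
  rw [← div_le_iff₀ hL] at hfine
  refine le_trans (le_of_eq ?_) hfine
  field_simp
  ring

end

/-- Quantitative rate of divergence: if `−α < 0` is the infimum of the asymptotic slopes of
`f` over all rays along which `f` is convex, `(x_k)` is a proximal sequence with step size
`τ` starting at `x₀ = ξ(0)` where `ξ` is a ray with `f ∘ ξ` convex and asymptotic slope
`−α`, then for all `k` and all `t > 0` with `f(ξ(t)) ≤ f(x_k)` one has
`(ξ(t)|x_k)_{x₀} ≥ k√τ ((α²/(4L) + α⁴/(16L³))√τ − 2√(2Lδ))`. -/
theorem proximal_sequence_rate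
    {X : Type*} [MetricSpace X] [ProperSpace X] (δ : ℝ) (hδ : 0 ≤ δ)
    (hgeo : ∀ x y : X, ∃ γ : ℝ → X, γ 0 = x ∧ γ 1 = y ∧
      ∀ s ∈ Icc (0:ℝ) 1, ∀ t ∈ Icc (0:ℝ) 1, dist (γ s) (γ t) = |s - t| * dist x y)
    (hhyp : ∀ p x y z : X,
      gromovProduct p x z ≥ min (gromovProduct p x y) (gromovProduct p y z) - δ)
    (L : ℝ) (hL : 0 < L) (f : X → ℝ)
    (hf : ∀ x y : X, |f x - f y| ≤ L * dist x y)
    (hconv : ∀ x y : X, ∃ γ : ℝ → X, γ 0 = x ∧ γ 1 = y ∧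
      (∀ s ∈ Icc (0:ℝ) 1, ∀ t ∈ Icc (0:ℝ) 1, dist (γ s) (γ t) = |s - t| * dist x y) ∧
      ∀ s ∈ Icc (0:ℝ) 1, f (γ s) ≤ (1 - s) * f x + s * f y)
    (α : ℝ) (hα : 0 < α)
    (hglb : IsGLB {a : ℝ | ∃ ξ : ℝ → X,
      (∀ s ∈ Ici (0:ℝ), ∀ t ∈ Ici (0:ℝ), dist (ξ s) (ξ t) = |s - t|) ∧
      ConvexOn ℝ (Ici (0:ℝ)) (fun t => f (ξ t)) ∧
      Tendsto (fun t => f (ξ t) / t) atTop (nhds a)} (-α))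
    (τ : ℝ) (hτ : 0 < τ) (x : ℕ → X)
    (hprox : ∀ k : ℕ, ∀ z : X,
      f (x (k + 1)) + dist (x k) (x (k + 1)) ^ 2 / (2 * τ) ≤
        f z + dist (x k) z ^ 2 / (2 * τ))
    (ξ : ℝ → X)
    (hξ : ∀ s ∈ Ici (0:ℝ), ∀ t ∈ Ici (0:ℝ), dist (ξ s) (ξ t) = |s - t|)
    (hξ0 : ξ 0 = x 0)
    (hξconv : ConvexOn ℝ (Ici (0:ℝ)) (fun t => f (ξ t)))
    (hξslope : Tendsto (fun t => f (ξ t) / t) atTop (nhds (-α))) :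
    ∀ k : ℕ, ∀ t > (0:ℝ), f (ξ t) ≤ f (x k) →
      k * Real.sqrt τ *
          ((α ^ 2 / (4 * L) + α ^ 4 / (16 * L ^ 3)) * Real.sqrt τ -
            2 * Real.sqrt (2 * L * δ)) ≤
        gromovProduct (x 0) (ξ t) (x k) := by
  have hanti : Antitone (fun k => f (x k)) := antitone_nat_of_succ_le fun k => by
    have h := hprox k (x k)
    have : 0 ≤ dist (x k) (x (k + 1)) ^ 2 / (2 * τ) := by positivity
    simp only [dist_self, ne_eq, OfNat.ofNat_ne_zero, not_false_eq_true, zero_pow, zero_div,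
      add_zero] at h
    linarith
  set c := α ^ 2 / (4 * L) + α ^ 4 / (16 * L ^ 3)
  set e := √τ * √(2 * L * δ) with he
  intro k t _ hk
  have hdist : ∀ j ≤ k, dist (x j) (ξ t) ≤ dist (x 0) (ξ t) - j * (2 * τ * c - 4 * e) := by
    intro j hj
    induction j with
    | zero => simp
    | succ j ih =>
      have h1 := ih (by omega)
      have h2 := dist_add_dist_proximal_le hδ hhyp hL.le hf hconv hτ (hprox j)
        (hk.trans (hanti hj))
      have h3 := le_dist_proximal hL hf hconv hτ (hprox j) hα.le hξ hξslope
      push_cast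
      linarith
  have h := hdist k le_rfl
  have h0 : 0 ≤ dist (x 0) (x k) := dist_nonneg
  have hrw : k * √τ * (c * √τ - 2 * √(2 * L * δ)) = k * (τ * c - 2 * e) := by
    rw [he]
    linear_combination (k * c) * Real.mul_self_sqrt hτ.le
  rw [hrw, gromovProduct, dist_comm (ξ t)]
  linarith
end
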